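/- arXiv:0909.5175 — 2 statements merged into one kernel-verified Lean document; each statement's English description precedes it below -/
import Mathlib

section
/- There is a universal constant C such that for every n ≥ 1, every d ≥ 1, and every degree-d polynomial threshold function f : {-1,1}^n → {-1,1}, the average sensitivity satisfies AS(f) ≤ C^d · n^{1 - 1/(4d+6)}. -/
open Finset MeasureTheory ProbabilityTheory
open scoped Classical

noncomputable section

/-- The ±1 real value of a Boolean bit (`true ↦ 1`, `false ↦ -1`). -/
def pmOne (b : Bool) : ℝ := if b then 1 else -1

/-- Noise sensitivity at rate `δ` of a Boolean function on the hypercube `{-1,1}^n`: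
`Pr[f(X) ≠ f(Z)]` where `X` is uniform and `Z` flips each coordinate of `X`
independently with probability `δ`. -/
def noiseSens {n : ℕ} (δ : ℝ) (f : (Fin n → Bool) → Bool) : ℝ :=
  (1 / 2 ^ n : ℝ) * ∑ x : Fin n → Bool, ∑ s : Fin n → Bool,
    (∏ i, if s i then δ else 1 - δ) * (if f x ≠ f (fun i => xor (s i) (x i)) then 1 else 0)

/-- Influence of the `i`-th variable: `Pr[f(X) ≠ f(X^{(i)})]`. -/
def influence {n : ℕ} (f : (Fin n → Bool) → Bool) (i : Fin n) : ℝ :=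
  (1 / 2 ^ n : ℝ) * ∑ x : Fin n → Bool,
    if f x ≠ f (Function.update x i (!x i)) then 1 else 0

/-- Average sensitivity (total influence). -/
def avgSens {n : ℕ} (f : (Fin n → Bool) → Bool) : ℝ := ∑ i, influence f i

/-- `f` is a degree-`d` polynomial threshold function: `f = sign(P)` for some real
polynomial of total degree at most `d`, with the convention `sign 0 = 1`. -/
def IsPTF {n : ℕ} (d : ℕ) (f : (Fin n → Bool) → Bool) : Prop :=
  ∃ P : MvPolynomial (Fin n) ℝ, P.totalDegree ≤ d ∧
    ∀ x, (f x = true ↔ 0 ≤ MvPolynomial.eval (fun i => pmOne (x i)) P)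

/-- Evaluation of the multilinear polynomial with coefficients `a` at the point `x`. -/
def mlEval {n : ℕ} (a : Finset (Fin n) → ℝ) (x : Fin n → ℝ) : ℝ :=
  ∑ I : Finset (Fin n), a I * ∏ i ∈ I, x i

/-- The multilinear polynomial with coefficients `a` has degree at most `d`. -/
def DegLE {n : ℕ} (a : Finset (Fin n) → ℝ) (d : ℕ) : Prop :=
  ∀ I, a I ≠ 0 → I.card ≤ d

/-- Squared weight `w_i²` of coordinate `i`: `Σ_{I ∋ i} a_I²`. -/
def wsq {n : ℕ} (a : Finset (Fin n) → ℝ) (i : Fin n) : ℝ :=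
  ∑ I ∈ univ.filter (fun I : Finset (Fin n) => i ∈ I), a I ^ 2

/-- `ε`-regularity: `Σ_i w_i⁴ ≤ ε² (Σ_i w_i²)²`. -/
def Regular {n : ℕ} (a : Finset (Fin n) → ℝ) (ε : ℝ) : Prop :=
  ∑ i, wsq a i ^ 2 ≤ ε ^ 2 * (∑ i, wsq a i) ^ 2

/-- `σ_{k+1}²(P) = Σ_{j ≥ k (0-based)} w_j²` (tail weight, `k` restricted variables). -/
def sigmaSq {n : ℕ} (a : Finset (Fin n) → ℝ) (k : ℕ) : ℝ :=
  ∑ j ∈ univ.filter (fun j : Fin n => k ≤ (j : ℕ)), wsq a j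

/-- The variables are ordered by decreasing weight. -/
def OrderedWeights {n : ℕ} (a : Finset (Fin n) → ℝ) : Prop :=
  ∀ i j : Fin n, i ≤ j → wsq a j ≤ wsq a i

/-- The `ε`-critical index `K(P,ε)`: least `k` such that `w_j² ≤ ε² σ_{k+1}²` for all
`j` beyond the first `k` variables. -/
def critIndex {n : ℕ} (a : Finset (Fin n) → ℝ) (ε : ℝ) : ℕ :=
  sInf {k : ℕ | ∀ j : Fin n, k ≤ (j : ℕ) → wsq a j ≤ ε ^ 2 * sigmaSq a k}

/-- Coefficients (in the variables `Y_j`, `j ≥ K`) of the restriction of the multilinear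
polynomial `a` obtained by fixing the first `K` variables to `x`. -/
def restCoeff {n : ℕ} (a : Finset (Fin n) → ℝ) (K : ℕ) (x : Fin n → ℝ)
    (J : Finset (Fin n)) : ℝ :=
  if ∀ j ∈ J, K ≤ (j : ℕ) then
    ∑ I ∈ univ.filter (fun I : Finset (Fin n) => I.filter (fun i => K ≤ i.val) = J),
      a I * ∏ i ∈ I.filter (fun i => i.val < K), x i
  else 0

/-- Standard Gaussian measure on `ℝ^n`. -/
def gaussn (n : ℕ) : Measure (Fin n → ℝ) := Measure.pi fun _ => gaussianReal 0 1

/-- Gaussian noise sensitivity: `Pr[f(X) ≠ f((1-δ)X + √(2δ-δ²)Y)]` for independent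
standard Gaussian vectors `X, Y`. -/
def gns (n : ℕ) (δ : ℝ) (f : (Fin n → ℝ) → ℝ) : ℝ :=
  (((gaussn n).prod (gaussn n))
    {p | f p.1 ≠ f (fun i => (1 - δ) * p.1 i + Real.sqrt (2 * δ - δ ^ 2) * p.2 i)}).toReal

/-- Normalized probabilists' Hermite polynomial `H_k(x)`. -/
def normHermite (k : ℕ) (x : ℝ) : ℝ :=
  Polynomial.aeval x (Polynomial.hermite k) / Real.sqrt (Nat.factorial k)


lemma pmOne_mul_self (b : Bool) : pmOne b * pmOne b = 1 := by
  cases b <;> norm_num [pmOne]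

lemma pmOne_not (b : Bool) : pmOne (!b) = -pmOne b := by
  cases b <;> norm_num [pmOne]

lemma sum_le_totalDegree {n : ℕ} {P : MvPolynomial (Fin n) ℝ} {m : Fin n →₀ ℕ}
    (hm : m ∈ P.support) : ∑ i, m i ≤ P.totalDegree := by
  have h := MvPolynomial.le_totalDegree hm
  rwa [Finsupp.sum_fintype _ _ (fun _ => rfl)] at h

/-- The discrete derivative of a polynomial on the cube has smaller degree. -/
lemma exists_discrete_derivative {n d : ℕ} {P : MvPolynomial (Fin n) ℝ}
    (hP : P.totalDegree ≤ d + 1) (i : Fin n) :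
    ∃ Q : MvPolynomial (Fin n) ℝ, Q.totalDegree ≤ d ∧ ∀ x : Fin n → Bool,
      MvPolynomial.eval (fun j => pmOne (x j)) Q =
        MvPolynomial.eval (fun j => pmOne (Function.update x i true j)) P -
          MvPolynomial.eval (fun j => pmOne (Function.update x i false j)) P := by
  refine ⟨∑ m ∈ P.support, MvPolynomial.C (P.coeff m * (1 - (-1) ^ m i)) *
    ∏ j ∈ univ.erase i, MvPolynomial.X j ^ m j, ?_, fun x => ?_⟩
  · refine MvPolynomial.totalDegree_finsetSum_le fun m hm => ?_
    rcases Nat.eq_zero_or_pos (m i) with h0 | hpos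
    · simp [h0]
    · refine (MvPolynomial.totalDegree_mul _ _).trans ?_
      rw [MvPolynomial.totalDegree_C, zero_add]
      refine (MvPolynomial.totalDegree_finsetProd _ _).trans ?_
      have h1 : ∑ j ∈ univ.erase i, (MvPolynomial.X (R := ℝ) j ^ m j).totalDegree ≤
          ∑ j ∈ univ.erase i, m j := by
        refine sum_le_sum fun j _ => ?_
        rw [MvPolynomial.totalDegree_X_pow]
      have h2 := sum_le_totalDegree hm
      rw [← add_sum_erase univ (fun j => m j) (mem_univ i)] at h2
      omega
  · rw [map_sum, MvPolynomial.eval_eq', MvPolynomial.eval_eq', ← sum_sub_distrib]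
    refine sum_congr rfl fun m _ => ?_
    have key : ∀ b : Bool, ∏ j, pmOne (Function.update x i b j) ^ m j =
        pmOne b ^ m i * ∏ j ∈ univ.erase i, pmOne (x j) ^ m j := by
      intro b
      rw [← mul_prod_erase univ _ (mem_univ i), Function.update_self]
      congr 1
      refine prod_congr rfl fun j hj => ?_
      rw [Function.update_of_ne (ne_of_mem_erase hj)]
    rw [key, key]
    simp only [map_mul, map_prod, map_pow, MvPolynomial.eval_C, MvPolynomial.eval_X]
    simp [pmOne]
    ring

/-- Flip the coordinates `j` with `w j = true` whose colour `c j` has sign `z (c j) = -1`. -/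
def colourFlip {n l : ℕ} (w : Fin n → Bool) (c : Fin n → Fin l) (z : Fin l → Bool)
    (x : Fin n → Bool) : Fin n → Bool :=
  fun j => if w j = true ∧ z (c j) = false then !x j else x j

/-- Flip the coordinates `j` of colour `b` with `w j = true`. -/
def blockFlip {n l : ℕ} (w : Fin n → Bool) (c : Fin n → Fin l) (b : Fin l)
    (x : Fin n → Bool) : Fin n → Bool :=
  fun j => if c j = b ∧ w j = true then !x j else x j

lemma colourFlip_involutive {n l : ℕ} (w : Fin n → Bool) (c : Fin n → Fin l)
    (z : Fin l → Bool) : Function.Involutive (colourFlip w c z) := by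
  intro x
  funext j
  simp only [colourFlip]
  split_ifs <;> simp

lemma colourFlip_update {n l : ℕ} (w : Fin n → Bool) (c : Fin n → Fin l)
    (z : Fin l → Bool) (b : Fin l) (x : Fin n → Bool) :
    colourFlip w c (Function.update z b (!z b)) x = blockFlip w c b (colourFlip w c z x) := by
  funext j
  simp only [colourFlip, blockFlip]
  by_cases h : c j = b
  · subst h
    cases w j <;> cases z (c j) <;> simp
  · simp [h]

lemma IsPTF.colourFlip {n l d : ℕ} {g : (Fin n → Bool) → Bool} (hg : IsPTF d g)
    (w : Fin n → Bool) (c : Fin n → Fin l) (x : Fin n → Bool) :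
    IsPTF d (fun z => g (colourFlip w c z x)) := by
  obtain ⟨P, hP, hgP⟩ := hg
  let u : Fin n → MvPolynomial (Fin l) ℝ := fun j =>
    MvPolynomial.C (pmOne (x j)) * (if w j = true then MvPolynomial.X (c j) else 1)
  have hu : ∀ j, (u j).totalDegree ≤ 1 := by
    intro j
    refine (MvPolynomial.totalDegree_mul _ _).trans ?_
    rw [MvPolynomial.totalDegree_C, zero_add]
    split_ifs <;> simp
  refine ⟨∑ m ∈ P.support, MvPolynomial.C (P.coeff m) * ∏ j, u j ^ m j, ?_, fun z => ?_⟩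
  · refine MvPolynomial.totalDegree_finsetSum_le fun m hm => ?_
    refine (MvPolynomial.totalDegree_mul _ _).trans ?_
    rw [MvPolynomial.totalDegree_C, zero_add]
    refine (MvPolynomial.totalDegree_finsetProd _ _).trans ?_
    refine le_trans (sum_le_sum fun j _ => ?_) ((sum_le_totalDegree hm).trans hP)
    refine (MvPolynomial.totalDegree_pow _ _).trans ?_
    exact (Nat.mul_le_mul_left _ (hu j)).trans (by simp)
  · rw [hgP, MvPolynomial.eval_eq', map_sum]
    have hval : ∀ j, MvPolynomial.eval (fun i => pmOne (z i)) (u j) =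
        pmOne (_root_.colourFlip w c z x j) := by
      intro j
      simp only [u, _root_.colourFlip, map_mul, MvPolynomial.eval_C]
      cases w j <;> cases hz : z (c j) <;> cases x j <;> simp [pmOne, hz]
    simp only [map_mul, map_prod, map_pow, MvPolynomial.eval_C, hval]

lemma two_pow_mul_avgSens {l : ℕ} (h : (Fin l → Bool) → Bool) :
    ∑ z : Fin l → Bool, ∑ b, (if h z ≠ h (Function.update z b (!z b)) then (1 : ℝ) else 0) =
      2 ^ l * avgSens h := by
  rw [sum_comm, avgSens, mul_sum]
  refine sum_congr rfl fun b _ => ?_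
  rw [influence, ← mul_assoc, mul_one_div_cancel (by positivity), one_mul]

/-- The total probability that a threshold function changes under flipping a random half of
one of `l` blocks is at most the largest average sensitivity on `l` variables. -/
lemma sum_blockFlip_le {n l d : ℕ} {A : ℝ}
    (hA : ∀ h : (Fin l → Bool) → Bool, IsPTF d h → avgSens h ≤ A)
    {g : (Fin n → Bool) → Bool} (hg : IsPTF d g) (w : Fin n → Bool) (c : Fin n → Fin l) :
    ∑ x : Fin n → Bool, ∑ b, (if g x ≠ g (blockFlip w c b x) then (1 : ℝ) else 0) ≤
      2 ^ n * A := by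
  set F : (Fin n → Bool) → ℝ :=
    fun x => ∑ b, (if g x ≠ g (blockFlip w c b x) then (1 : ℝ) else 0) with hF
  have h1 : ∀ z : Fin l → Bool, ∑ x, F (colourFlip w c z x) = ∑ x, F x := fun z =>
    Equiv.sum_comp (colourFlip_involutive w c z).toPerm F
  have h2 : (2 : ℝ) ^ l * ∑ x, F x = ∑ x, ∑ z, F (colourFlip w c z x) := by
    rw [show ∑ x, ∑ z, F (colourFlip w c z x) = ∑ z, ∑ x, F (colourFlip w c z x) from sum_comm,
      sum_congr rfl fun z _ => h1 z]
    simp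
  have h3 : ∀ x, ∑ z, F (colourFlip w c z x) ≤ 2 ^ l * A := by
    intro x
    have := two_pow_mul_avgSens (fun z => g (colourFlip w c z x))
    simp only [colourFlip_update] at this
    rw [hF, this]
    gcongr
    exact hA _ (hg.colourFlip w c x)
  have h4 : ∑ x : Fin n → Bool, ∑ z, F (colourFlip w c z x) ≤ 2 ^ n * (2 ^ l * A) := by
    refine (sum_le_sum fun x _ => h3 x).trans ?_
    simp
  rw [← h2] at h4
  have : (0 : ℝ) < 2 ^ l := by positivity
  nlinarith

lemma sum_apply_eq_of_update_invariant {n l : ℕ} (i : Fin n)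
    (F : Fin l → (Fin n → Fin l) → ℝ) (hF : ∀ b c a, F b (Function.update c i a) = F b c) :
    l * ∑ c, F (c i) c = ∑ c, ∑ b, F b c := by
  have hinv : Function.Involutive
      (fun p : (Fin n → Fin l) × Fin l => (Function.update p.1 i p.2, p.1 i)) := by
    rintro ⟨c, a⟩
    simp
  have h := Equiv.sum_comp hinv.toPerm (fun p : (Fin n → Fin l) × Fin l => F (p.1 i) p.1)
  rw [Fintype.sum_prod_type, Fintype.sum_prod_type] at h
  simp only [Function.Involutive.coe_toPerm, Function.update_self, hF, sum_const, card_univ,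
    Fintype.card_fin, nsmul_eq_mul] at h
  rw [h, mul_sum]

lemma sum_influence_eq {n : ℕ} {f g : (Fin n → Bool) → Bool} {i : Fin n}
    (hg : ∀ x b, g (Function.update x i b) = g x)
    (hfg : ∀ x, f x ≠ f (Function.update x i (!x i)) → (f x = true ↔ x i = g x)) :
    ∑ x, (if f x ≠ f (Function.update x i (!x i)) then (1 : ℝ) else 0) =
      ∑ x, pmOne (f x) * pmOne (x i) * pmOne (g x) := by
  have hinv : Function.Involutive (fun x : Fin n → Bool => Function.update x i (!x i)) := by
    intro x
    simp
  have h := Equiv.sum_comp hinv.toPerm (fun x => pmOne (f x) * pmOne (x i) * pmOne (g x))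
  simp only [Function.Involutive.coe_toPerm, Function.update_self, hg, pmOne_not] at h
  have h2 : ∀ x, 2 * (if f x ≠ f (Function.update x i (!x i)) then (1 : ℝ) else 0) =
      pmOne (f x) * pmOne (x i) * pmOne (g x) +
        pmOne (f (Function.update x i (!x i))) * -pmOne (x i) * pmOne (g x) := by
    intro x
    have := hfg x
    revert this
    cases f x <;> cases f (Function.update x i (!x i)) <;> cases x i <;> cases g x <;>
      norm_num [pmOne]
  have h3 := sum_congr (rfl : (univ : Finset (Fin n → Bool)) = univ) fun x _ => h2 x
  rw [sum_add_distrib, h, ← mul_sum] at h3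
  linarith

lemma sum_pmOne_blockFlip_eq_zero {n l : ℕ} (c : Fin n → Fin l) (b : Fin l)
    (G : (Fin n → Bool) → ℝ) {i j : Fin n} (hij : i ≠ j) (hi : c i = b) :
    ∑ p : (Fin n → Bool) × (Fin n → Bool),
      pmOne (p.1 i) * pmOne (p.1 j) * G (blockFlip p.2 c b p.1) = 0 := by
  have hinv : Function.Involutive (fun p : (Fin n → Bool) × (Fin n → Bool) =>
      (Function.update p.1 i (!p.1 i), Function.update p.2 i (!p.2 i))) := by
    rintro ⟨x, w⟩
    simp
  have h := Equiv.sum_comp hinv.toPerm (fun p : (Fin n → Bool) × (Fin n → Bool) =>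
    pmOne (p.1 i) * pmOne (p.1 j) * G (blockFlip p.2 c b p.1))
  have hflip : ∀ x w : Fin n → Bool, blockFlip (Function.update w i (!w i)) c b
      (Function.update x i (!x i)) = blockFlip w c b x := by
    intro x w
    funext k
    simp only [blockFlip]
    by_cases hk : k = i
    · subst hk
      cases w k <;> simp [hi]
    · simp [Function.update_of_ne hk]
  simp only [Function.Involutive.coe_toPerm, hflip, Function.update_self,
    Function.update_of_ne hij.symm, pmOne_not, neg_mul, sum_neg_distrib] at h
  linarith

lemma sum_sq_block {n l : ℕ} (g : Fin n → (Fin n → Bool) → Bool) (c : Fin n → Fin l)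
    (b : Fin l) :
    ∑ p : (Fin n → Bool) × (Fin n → Bool),
      (∑ i, if c i = b then pmOne (p.1 i) * pmOne (g i (blockFlip p.2 c b p.1)) else 0) ^ 2 =
      2 ^ n * 2 ^ n * ∑ i, if c i = b then (1 : ℝ) else 0 := by
  simp only [sq, sum_mul_sum]
  rw [sum_comm, mul_sum]
  refine sum_congr rfl fun i _ => ?_
  rw [sum_comm, sum_eq_single i]
  · by_cases hi : c i = b
    · simp only [hi, if_true]
      rw [sum_congr rfl fun p _ => show _ = (1 : ℝ) by
        rw [mul_mul_mul_comm, pmOne_mul_self, pmOne_mul_self, one_mul]]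
      simp
    · simp [hi]
  · intro j _ hj
    by_cases hi : c i = b
    · by_cases hjb : c j = b
      · simp only [hi, hjb, if_true]
        rw [← sum_pmOne_blockFlip_eq_zero c b
          (fun y => pmOne (g i y) * pmOne (g j y)) hj.symm hi]
        refine sum_congr rfl fun p _ => ?_
        ring
      · simp [hjb]
    · simp [hi]
  · simp

lemma sum_decoupled_le {n l : ℕ} (f : (Fin n → Bool) → Bool)
    (g : Fin n → (Fin n → Bool) → Bool) (c : Fin n → Fin l) :
    ∑ p : (Fin n → Bool) × (Fin n → Bool), ∑ i,
      pmOne (f p.1) * pmOne (p.1 i) * pmOne (g i (blockFlip p.2 c (c i) p.1)) ≤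
      2 ^ n * 2 ^ n * √(l * n) := by
  set Z : ((Fin n → Bool) × (Fin n → Bool)) → Fin l → ℝ := fun p b =>
    ∑ i, if c i = b then pmOne (p.1 i) * pmOne (g i (blockFlip p.2 c b p.1)) else 0 with hZ
  have h1 : ∀ p : (Fin n → Bool) × (Fin n → Bool), ∑ i,
      pmOne (f p.1) * pmOne (p.1 i) * pmOne (g i (blockFlip p.2 c (c i) p.1)) =
      ∑ b, pmOne (f p.1) * Z p b := by
    intro p
    simp only [hZ]
    rw [← mul_sum, sum_comm, mul_sum]
    refine sum_congr rfl fun i _ => ?_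
    rw [sum_ite_eq, if_pos (mem_univ _), mul_assoc]
  have h2 : ∑ p, ∑ b, Z p b ^ 2 = 2 ^ n * 2 ^ n * n := by
    rw [sum_comm, sum_congr rfl fun b _ => sum_sq_block g c b, ← mul_sum, sum_comm]
    simp
  rw [sum_congr rfl fun p _ => h1 p, ← Fintype.sum_prod_type']
  refine (Real.sum_mul_le_sqrt_mul_sqrt _ _ _).trans ?_
  rw [Fintype.sum_prod_type (fun q : ((Fin n → Bool) × (Fin n → Bool)) × Fin l =>
    Z q.1 q.2 ^ 2), h2]
  simp only [sq, pmOne_mul_self]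
  simp only [sum_const, card_univ, Fintype.card_prod, Fintype.card_pi, Fintype.card_bool,
    Fintype.card_fin, prod_const, nsmul_eq_mul]
  push_cast
  rw [← Real.sqrt_mul (by positivity)]
  apply le_of_eq
  rw [show (2 : ℝ) ^ n * 2 ^ n * l * 1 * (2 ^ n * 2 ^ n * n) =
    (2 ^ n * 2 ^ n) ^ 2 * (l * n) by ring, Real.sqrt_mul (by positivity),
    Real.sqrt_sq (by positivity)]

lemma blockFlip_update_eq {n l : ℕ} (w : Fin n → Bool) (c : Fin n → Fin l) (b a : Fin l)
    (x : Fin n → Bool) (i : Fin n) : ∃ v,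
    blockFlip w (Function.update c i a) b x = Function.update (blockFlip w c b x) i v := by
  refine ⟨blockFlip w (Function.update c i a) b x i, ?_⟩
  funext j
  by_cases hj : j = i
  · subst hj
    simp
  · simp [blockFlip, Function.update_of_ne hj]

/-- Decoupling estimate: if the sign of the derivative of `f` in direction `i` is `g i`, then
the average sensitivity of `f` is controlled by that of lower degree threshold functions in
`l` variables. -/
lemma avgSens_le_of_derivative_signs {n l d : ℕ} {A : ℝ} (hl : 0 < l)
    (hA : ∀ h : (Fin l → Bool) → Bool, IsPTF d h → avgSens h ≤ A)
    {f : (Fin n → Bool) → Bool} {g : Fin n → (Fin n → Bool) → Bool}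
    (hg : ∀ i, IsPTF d (g i)) (hgi : ∀ i x b, g i (Function.update x i b) = g i x)
    (hfg : ∀ i x, f x ≠ f (Function.update x i (!x i)) → (f x = true ↔ x i = g i x)) :
    avgSens f ≤ √(l * n) + 2 * n * A / l := by
  have hl' : (0 : ℝ) < l := by exact_mod_cast hl
  let I : Fin n → (Fin n → Bool) × (Fin n → Bool) → Fin l → (Fin n → Fin l) → ℝ :=
    fun i p b c => if g i p.1 ≠ g i (blockFlip p.2 c b p.1) then 1 else 0
  have hpt : ∀ c : Fin n → Fin l, 2 ^ n * (2 ^ n * avgSens f) ≤ 2 ^ n * 2 ^ n * √(l * n) +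
      2 * ∑ p, ∑ i, I i p (c i) c := by
    intro c
    have h1 : (2 : ℝ) ^ n * (2 ^ n * avgSens f) =
        ∑ p : (Fin n → Bool) × (Fin n → Bool), ∑ i,
          pmOne (f p.1) * pmOne (p.1 i) * pmOne (g i p.1) := by
      rw [← two_pow_mul_avgSens, Fintype.sum_prod_type, sum_comm,
        sum_congr rfl fun i _ => sum_influence_eq (hgi i) (hfg i), sum_comm]
      simp [mul_sum]
    rw [h1]
    refine le_trans ?_ (add_le_add_left (sum_decoupled_le f g c) _)
    rw [mul_sum, ← sum_add_distrib]
    refine sum_le_sum fun p _ => ?_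
    rw [mul_sum, ← sum_add_distrib]
    refine sum_le_sum fun i _ => ?_
    simp only [I]
    cases f p.1 <;> cases p.1 i <;> cases g i p.1 <;>
      cases g i (blockFlip p.2 c (c i) p.1) <;> norm_num [pmOne]
  have hnoise : ∀ i, (l : ℝ) * ∑ c, ∑ p, I i p (c i) c ≤
      (l : ℝ) ^ n * (2 ^ n * (2 ^ n * A)) := by
    intro i
    have h1 : ∀ p, (l : ℝ) * ∑ c, I i p (c i) c = ∑ c, ∑ b, I i p b c := by
      intro p
      refine sum_apply_eq_of_update_invariant i (I i p) fun b c a => ?_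
      obtain ⟨v, hv⟩ := blockFlip_update_eq p.2 c b a p.1 i
      simp only [I, hv, hgi]
    rw [sum_comm, mul_sum, sum_congr rfl fun p _ => h1 p, sum_comm]
    have h2 : ∀ c : Fin n → Fin l, ∑ p, ∑ b, I i p b c ≤ 2 ^ n * (2 ^ n * A) := by
      intro c
      rw [Fintype.sum_prod_type_right]
      refine (sum_le_sum fun w _ => sum_blockFlip_le hA (hg i) w c).trans ?_
      simp
    refine (sum_le_sum fun c _ => h2 c).trans ?_
    simp
  have hsum : ∑ _c : Fin n → Fin l, (2 : ℝ) ^ n * (2 ^ n * avgSens f) ≤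
      ∑ _c : Fin n → Fin l, (2 : ℝ) ^ n * 2 ^ n * √(l * n) +
        2 * ∑ c : Fin n → Fin l, ∑ p, ∑ i, I i p (c i) c := by
    rw [mul_sum, ← sum_add_distrib]
    exact sum_le_sum fun c _ => hpt c
  have hswap : ∑ c : Fin n → Fin l, ∑ p, ∑ i, I i p (c i) c =
      ∑ i, ∑ c : Fin n → Fin l, ∑ p, I i p (c i) c := by
    rw [sum_congr rfl fun c _ => sum_comm, sum_comm]
  have hn : (l : ℝ) * ∑ i, ∑ c : Fin n → Fin l, ∑ p, I i p (c i) c ≤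
      n * ((l : ℝ) ^ n * (2 ^ n * (2 ^ n * A))) := by
    rw [mul_sum]
    refine (sum_le_sum fun i _ => hnoise i).trans ?_
    simp
  rw [hswap] at hsum
  simp only [sum_const, card_univ, Fintype.card_pi, Fintype.card_fin, prod_const,
    nsmul_eq_mul] at hsum
  push_cast at hsum
  have hK : (0 : ℝ) < (l : ℝ) ^ n * (2 ^ n * 2 ^ n) := by positivity
  have hn' : ∑ i, ∑ c : Fin n → Fin l, ∑ p, I i p (c i) c ≤
      (l : ℝ) ^ n * (2 ^ n * 2 ^ n) * (n * A / l) := by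
    rw [← mul_div_assoc, le_div_iff₀ hl']
    linarith
  refine le_of_mul_le_mul_left ?_ hK
  calc (l : ℝ) ^ n * (2 ^ n * 2 ^ n) * avgSens f
      = (l : ℝ) ^ n * (2 ^ n * (2 ^ n * avgSens f)) := by ring
    _ ≤ _ := hsum
    _ ≤ (l : ℝ) ^ n * (2 ^ n * 2 ^ n * √(l * n)) +
        2 * ((l : ℝ) ^ n * (2 ^ n * 2 ^ n) * (n * A / l)) := by linarith
    _ = _ := by ring

lemma IsPTF.avgSens_le_succ {n l d : ℕ} {A : ℝ} (hl : 0 < l)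
    (hA : ∀ h : (Fin l → Bool) → Bool, IsPTF d h → avgSens h ≤ A)
    {f : (Fin n → Bool) → Bool} (hf : IsPTF (d + 1) f) :
    avgSens f ≤ √(l * n) + 2 * n * A / l := by
  obtain ⟨P, hP, hfP⟩ := hf
  choose Q hQ hQP using exists_discrete_derivative hP
  refine avgSens_le_of_derivative_signs hl hA
    (g := fun i x => decide (0 ≤ MvPolynomial.eval (fun j => pmOne (x j)) (Q i)))
    (fun i => ⟨Q i, hQ i, fun x => by simp⟩) (fun i x b => by simp [hQP]) fun i x hne => ?_
  have hP' := fun v => hfP (Function.update x i v)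
  have hx : f x = f (Function.update x i (x i)) := by rw [Function.update_eq_self]
  rw [hx] at hne ⊢
  rw [hQP]
  revert hne
  generalize x i = v
  have hT := hP' true
  have hF := hP' false
  revert hT hF
  cases v <;> simp only [Bool.not_true, Bool.not_false] <;>
    cases f (Function.update x i true) <;> cases f (Function.update x i false) <;>
    simp <;> intros <;> linarith

lemma IsPTF.avgSens_eq_zero {n : ℕ} {f : (Fin n → Bool) → Bool} (hf : IsPTF 0 f) :
    avgSens f = 0 := by
  obtain ⟨P, hP, hfP⟩ := hf
  have h := MvPolynomial.totalDegree_eq_zero_iff_eq_C.1 (Nat.le_zero.1 hP)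
  have hc : ∀ x y, f x = f y := by
    intro x y
    rw [Bool.eq_iff_iff, hfP, hfP, h]
    simp
  have h0 : ∀ (x : Fin n → Bool) i, ¬ f x ≠ f (Function.update x i (!x i)) :=
    fun x i => not_not.2 (hc _ _)
  simp only [avgSens, influence, h0, if_false, sum_const_zero, mul_zero]

lemma IsPTF.avgSens_le_rpow (d : ℕ) : ∀ (n : ℕ), 1 ≤ n → ∀ f : (Fin n → Bool) → Bool,
    IsPTF (d + 1) f → avgSens f ≤ 6 ^ (d + 1) * (n : ℝ) ^ (1 - 1 / (2 * ((d : ℝ) + 1))) := by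
  induction d with
  | zero =>
    intro n _ f hf
    have h := hf.avgSens_le_succ (l := 1) (A := 0) one_pos fun h hh => hh.avgSens_eq_zero.le
    norm_num at h ⊢
    rw [Real.sqrt_eq_rpow] at h
    have : (0 : ℝ) ≤ (n : ℝ) ^ (1 / 2 : ℝ) := by positivity
    linarith
  | succ d ih =>
    intro n hn f hf
    have hn1 : (1 : ℝ) ≤ n := by exact_mod_cast hn
    have hn0 : (0 : ℝ) < n := by linarith
    set e : ℝ := (d + 1) / (d + 2) with he
    set t : ℝ := (n : ℝ) ^ e with ht
    have ht1 : 1 ≤ t := Real.one_le_rpow hn1 (by positivity)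
    set l := ⌈t⌉₊ with hl
    have htl : t ≤ l := Nat.le_ceil t
    have hlt : (l : ℝ) ≤ 2 * t := by
      have := Nat.ceil_lt_add_one (show 0 ≤ t by linarith)
      linarith
    have hl0 : 0 < l := Nat.ceil_pos.2 (by linarith)
    have hlr : (0 : ℝ) < l := by linarith
    have h := hf.avgSens_le_succ hl0 (ih l hl0)
    push_cast
    set B : ℝ := (n : ℝ) ^ (1 - 1 / (2 * ((d : ℝ) + 1 + 1))) with hB
    have hB0 : 0 < B := by positivity
    have hsqrt : √(l * n) ≤ 2 * B := by
      rw [Real.sqrt_le_left (by positivity)]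
      have hB2 : B ^ 2 = t * n := by
        rw [hB, ht, ← Real.rpow_natCast, ← Real.rpow_mul hn0.le, ← Real.rpow_add_one hn0.ne']
        congr 1
        rw [he]
        push_cast
        field_simp
        ring
      rw [mul_pow, hB2]
      have : 0 < t * n := by positivity
      nlinarith
    have hdiv : (l : ℝ) ^ (1 - 1 / (2 * ((d : ℝ) + 1))) / l ≤
        (n : ℝ) ^ (-(1 / (2 * ((d : ℝ) + 1 + 1)))) := by
      rw [← Real.rpow_sub_one hlr.ne']
      refine (Real.rpow_le_rpow_of_nonpos (by linarith) htl ?_).trans_eq ?_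
      · have : 0 ≤ 1 / (2 * ((d : ℝ) + 1)) := by positivity
        linarith
      · rw [ht, ← Real.rpow_mul hn0.le]
        congr 1
        rw [he]
        field_simp
        ring
    have hBn : B = n * (n : ℝ) ^ (-(1 / (2 * ((d : ℝ) + 1 + 1)))) := by
      rw [hB, sub_eq_add_neg, Real.rpow_add hn0, Real.rpow_one]
    have hsecond : 2 * n * (6 ^ (d + 1) * (l : ℝ) ^ (1 - 1 / (2 * ((d : ℝ) + 1)))) / l ≤
        2 * 6 ^ (d + 1) * B := by
      calc _ = 2 * 6 ^ (d + 1) * (n * ((l : ℝ) ^ (1 - 1 / (2 * ((d : ℝ) + 1))) / l)) := by ring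
        _ ≤ 2 * 6 ^ (d + 1) *
            (n * (n : ℝ) ^ (-(1 / (2 * ((d : ℝ) + 1 + 1))))) := by gcongr
        _ = _ := by rw [hBn]
    have h6 : (1 : ℝ) ≤ 6 ^ (d + 1) := one_le_pow₀ (by norm_num)
    calc avgSens f ≤ _ := h
      _ ≤ 2 * B + 2 * 6 ^ (d + 1) * B := add_le_add hsqrt hsecond
      _ ≤ 6 ^ (d + 1 + 1) * B := by
        rw [pow_succ (6 : ℝ) (d + 1)]
        nlinarith

/-- Theorem 1.5: there is a universal constant `C` such that every
degree-`d` PTF `f` on `{-1,1}^n` has average sensitivity `AS(f) ≤ C^d · n^{1-1/(4d+6)}`. -/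
theorem average_sensitivity_of_PTF :
    ∃ C : ℝ, 0 < C ∧ ∀ (n d : ℕ), 1 ≤ n → 1 ≤ d →
      ∀ f : (Fin n → Bool) → Bool, IsPTF d f →
        avgSens f ≤ C ^ d * (n : ℝ) ^ ((1 : ℝ) - 1 / (4 * (d : ℝ) + 6)) := by
  refine ⟨6, by norm_num, fun n d hn hd f hf => ?_⟩
  obtain ⟨k, rfl⟩ := Nat.exists_eq_add_of_le' hd
  refine (IsPTF.avgSens_le_rpow k n hn f hf).trans ?_
  have hn1 : (1 : ℝ) ≤ n := by exact_mod_cast hn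
  gcongr
  · push_cast
    linarith

end
end

section
/- For every integer d ≥ 1 there is a constant C_d such that the following holds for every ε ∈ (0,1). Let P be a nonzero ε-regular multilinear polynomial of degree at most d with zero constant term, let θ ∈ R, and let f(x) = sign(P(x) − θ). Then NS_ε(f) ≤ C_d · ε^{1/(2d+2)}. -/
open Finset MeasureTheory ProbabilityTheory
open scoped Classical

noncomputable section

section FiniteMoments

variable {Ω : Type*} [MeasurableSpace Ω] {μ : Measure Ω}

/-- A measurable function all of whose absolute moments are finite. -/
structure FiniteMoments (f : Ω → ℝ) (μ : Measure Ω) : Prop where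
  measurable : Measurable f
  integrable_abs_pow : ∀ p : ℕ, Integrable (fun ω => |f ω| ^ p) μ

namespace FiniteMoments

variable {f g : Ω → ℝ}

lemma integrable_pow (hf : FiniteMoments f μ) (p : ℕ) : Integrable (fun ω => f ω ^ p) μ :=
  (hf.integrable_abs_pow p).mono' (hf.measurable.pow_const p).aestronglyMeasurable
    (.of_forall fun ω => by simp)

lemma integrable (hf : FiniteMoments f μ) : Integrable f μ := by
  simpa using hf.integrable_pow 1

lemma const [IsFiniteMeasure μ] (c : ℝ) : FiniteMoments (fun _ : Ω => c) μ :=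
  ⟨measurable_const, fun _ => integrable_const _⟩

lemma mul (hf : FiniteMoments f μ) (hg : FiniteMoments g μ) :
    FiniteMoments (fun ω => f ω * g ω) μ := by
  refine ⟨hf.measurable.mul hg.measurable, fun p => ?_⟩
  refine ((hf.integrable_abs_pow (p * 2)).add (hg.integrable_abs_pow (p * 2))).mono'
    (((hf.measurable.mul hg.measurable).abs).pow_const p).aestronglyMeasurable
    (.of_forall fun ω => ?_)
  simp only [Pi.add_apply, Real.norm_eq_abs, abs_pow, abs_abs, abs_mul, mul_pow,
    pow_mul]
  nlinarith [sq_nonneg (|f ω| ^ p - |g ω| ^ p), sq_nonneg (|f ω| ^ p), sq_nonneg (|g ω| ^ p)]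

lemma add (hf : FiniteMoments f μ) (hg : FiniteMoments g μ) :
    FiniteMoments (fun ω => f ω + g ω) μ := by
  refine ⟨hf.measurable.add hg.measurable, fun p => ?_⟩
  refine (((hf.integrable_abs_pow p).add (hg.integrable_abs_pow p)).const_mul (2 ^ (p - 1))).mono'
    (((hf.measurable.add hg.measurable).abs).pow_const p).aestronglyMeasurable
    (.of_forall fun ω => ?_)
  simp only [Pi.add_apply, Real.norm_eq_abs, abs_pow, abs_abs]
  exact (pow_le_pow_left₀ (abs_nonneg _) (abs_add_le _ _) p).trans
    (add_pow_le (abs_nonneg _) (abs_nonneg _) p)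

lemma const_mul [IsFiniteMeasure μ] (hf : FiniteMoments f μ) (c : ℝ) :
    FiniteMoments (fun ω => c * f ω) μ := (const c).mul hf

lemma pow [IsFiniteMeasure μ] (hf : FiniteMoments f μ) (p : ℕ) :
    FiniteMoments (fun ω => f ω ^ p) μ := by
  induction p with
  | zero => simpa using const 1
  | succ p ih => simpa only [pow_succ] using ih.mul hf

lemma sum [IsFiniteMeasure μ] {ι : Type*} {F : ι → Ω → ℝ} (s : Finset ι)
    (hF : ∀ i ∈ s, FiniteMoments (F i) μ) : FiniteMoments (fun ω => ∑ i ∈ s, F i ω) μ := by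
  induction s using Finset.induction_on with
  | empty => simpa using const 0
  | insert i s hi ih =>
    simp only [sum_insert hi]
    exact (hF i (mem_insert_self _ _)).add (ih fun j hj => hF j (mem_insert_of_mem hj))

lemma prod [IsFiniteMeasure μ] {ι : Type*} {F : ι → Ω → ℝ} (s : Finset ι)
    (hF : ∀ i ∈ s, FiniteMoments (F i) μ) : FiniteMoments (fun ω => ∏ i ∈ s, F i ω) μ := by
  induction s using Finset.induction_on with
  | empty => simpa using const 1
  | insert i s hi ih =>
    simp only [prod_insert hi]
    exact (hF i (mem_insert_self _ _)).mul (ih fun j hj => hF j (mem_insert_of_mem hj))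

end FiniteMoments

/-- Weighted arithmetic-geometric mean inequality with natural exponents. -/
lemma pow_mul_pow_le_weighted {x y : ℝ} (hx : 0 ≤ x) (hy : 0 ≤ y) {q j : ℕ} (hq : q ≠ 0)
    (hj : j ≤ q) :
    x ^ j * y ^ (q - j) ≤ (j / q : ℝ) * x ^ q + (1 - j / q : ℝ) * y ^ q := by
  have hq' : (0 : ℝ) < q := by positivity
  have hjq : (j : ℝ) / q ≤ 1 := by
    rw [div_le_one hq']; exact_mod_cast hj
  have h := Real.geom_mean_le_arith_mean2_weighted (w₁ := j / q) (w₂ := 1 - j / q)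
    (by positivity) (by linarith) (pow_nonneg hx q) (pow_nonneg hy q) (by ring)
  rw [← Real.rpow_natCast x q, ← Real.rpow_natCast y q, ← Real.rpow_mul hx, ← Real.rpow_mul hy] at h
  have e1 : (q : ℝ) * (j / q) = j := by field_simp
  have e2 : (q : ℝ) * (1 - j / q) = ((q - j : ℕ) : ℝ) := by
    rw [Nat.cast_sub hj]; field_simp
  rwa [e1, e2, Real.rpow_natCast, Real.rpow_natCast, Real.rpow_natCast, Real.rpow_natCast] at h

/-- Hölder's inequality for mixed moments, in terms of bounds on the pure moments. -/
lemma integral_pow_mul_pow_le [IsProbabilityMeasure μ] {u v : Ω → ℝ} (hu : FiniteMoments u μ)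
    (hv : FiniteMoments v μ) (hu0 : ∀ ω, 0 ≤ u ω) (hv0 : ∀ ω, 0 ≤ v ω) {A B : ℝ} (hA : 0 ≤ A)
    (hB : 0 ≤ B) {q j : ℕ} (hj : j ≤ q) (hAu : ∫ ω, u ω ^ q ∂μ ≤ A ^ q)
    (hBv : ∫ ω, v ω ^ q ∂μ ≤ B ^ q) :
    ∫ ω, u ω ^ j * v ω ^ (q - j) ∂μ ≤ A ^ j * B ^ (q - j) := by
  rcases eq_or_ne q 0 with rfl | hq
  · obtain rfl : j = 0 := by omega
    simp
  have key : ∀ η : ℝ, 0 < η →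
      ∫ ω, u ω ^ j * v ω ^ (q - j) ∂μ ≤ (A + η) ^ j * (B + η) ^ (q - j) := by
    intro η hη
    have hA' : 0 < A + η := by linarith
    have hB' : 0 < B + η := by linarith
    have hjq : (j : ℝ) / q ≤ 1 := by
      rw [div_le_one (by positivity)]; exact_mod_cast hj
    have hpt : ∀ ω, u ω ^ j * v ω ^ (q - j) ≤ (A + η) ^ j * (B + η) ^ (q - j) *
        ((j / q : ℝ) / (A + η) ^ q * u ω ^ q + (1 - j / q : ℝ) / (B + η) ^ q * v ω ^ q) := by
      intro ω
      have h := pow_mul_pow_le_weighted (div_nonneg (hu0 ω) hA'.le) (div_nonneg (hv0 ω) hB'.le)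
        hq hj
      have h2 := mul_le_mul_of_nonneg_left h
        (show 0 ≤ (A + η) ^ j * (B + η) ^ (q - j) by positivity)
      calc u ω ^ j * v ω ^ (q - j) = (A + η) ^ j * (B + η) ^ (q - j) *
            ((u ω / (A + η)) ^ j * (v ω / (B + η)) ^ (q - j)) := by
            rw [div_pow, div_pow]; field_simp
        _ ≤ _ := h2
        _ = _ := by rw [div_pow, div_pow]; ring
    have hint : Integrable (fun ω => (j / q : ℝ) / (A + η) ^ q * u ω ^ q +
        (1 - j / q : ℝ) / (B + η) ^ q * v ω ^ q) μ :=
      ((hu.integrable_pow q).const_mul _).add ((hv.integrable_pow q).const_mul _)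
    have h1 := integral_mono ((hu.pow j).mul (hv.pow (q - j))).integrable (hint.const_mul _) hpt
    refine h1.trans ?_
    rw [integral_const_mul, integral_add ((hu.integrable_pow q).const_mul _)
      ((hv.integrable_pow q).const_mul _), integral_const_mul, integral_const_mul]
    refine mul_le_of_le_one_right (by positivity) ?_
    have hA2 : A ^ q ≤ (A + η) ^ q := pow_le_pow_left₀ hA (by linarith) q
    have hB2 : B ^ q ≤ (B + η) ^ q := pow_le_pow_left₀ hB (by linarith) q
    calc _ ≤ (j / q : ℝ) / (A + η) ^ q * (A + η) ^ q
          + (1 - j / q : ℝ) / (B + η) ^ q * (B + η) ^ q := by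
          refine add_le_add (mul_le_mul_of_nonneg_left (hAu.trans hA2) (by positivity))
            (mul_le_mul_of_nonneg_left (hBv.trans hB2) (div_nonneg (by linarith) (by positivity)))
      _ = 1 := by field_simp; ring
  have hcont : Continuous fun η : ℝ => (A + η) ^ j * (B + η) ^ (q - j) := by fun_prop
  have htend := (hcont.tendsto 0).mono_left (nhdsWithin_le_nhds (s := Set.Ioi 0))
  simp only [add_zero] at htend
  exact ge_of_tendsto htend (Filter.eventually_of_mem self_mem_nhdsWithin fun η hη => key η hη)

/-- Minkowski's inequality for finitely many nonnegative functions, in terms of bounds on the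
moments. -/
lemma integral_sum_pow_le [IsProbabilityMeasure μ] {ι : Type*} {u : ι → Ω → ℝ} {m : ι → ℝ}
    (hu : ∀ i, FiniteMoments (u i) μ) (hu0 : ∀ i ω, 0 ≤ u i ω) (hm : ∀ i, 0 ≤ m i) (q : ℕ)
    (hum : ∀ i, ∫ ω, u i ω ^ q ∂μ ≤ m i ^ q) (s : Finset ι) :
    ∫ ω, (∑ i ∈ s, u i ω) ^ q ∂μ ≤ (∑ i ∈ s, m i) ^ q := by
  induction s using Finset.induction_on with
  | empty => simp
  | insert i s hi ih =>
    have hS : FiniteMoments (fun ω => ∑ i ∈ s, u i ω) μ := FiniteMoments.sum s fun i _ => hu i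
    simp only [sum_insert hi, add_pow]
    rw [integral_finsetSum _ fun j _ =>
      ((((hu i).pow j).mul (hS.pow (q - j))).integrable).mul_const _]
    refine sum_le_sum fun j hj => ?_
    rw [integral_mul_const]
    refine mul_le_mul_of_nonneg_right ?_ (by positivity)
    exact integral_pow_mul_pow_le (hu i) hS (hu0 i) (fun ω => sum_nonneg fun k _ => hu0 k ω)
      (hm i) (sum_nonneg fun k _ => hm k) (by simpa [Nat.lt_succ_iff] using hj) (hum i) ih

/-- A form of the Paley–Zygmund inequality. -/
lemma paley_zygmund [IsProbabilityMeasure μ] {f : Ω → ℝ} (hf : FiniteMoments f μ) {V κ : ℝ}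
    (hV : 0 < V) (hκ : 0 < κ) (h2 : ∫ ω, f ω ^ 2 ∂μ = V) (h4 : ∫ ω, f ω ^ 4 ∂μ ≤ κ * V ^ 2) :
    1 / (4 * κ) ≤ μ.real {ω | V / 2 ≤ f ω ^ 2} := by
  set A : Set Ω := {ω | V / 2 ≤ f ω ^ 2} with hA
  have hAm : MeasurableSet A := measurableSet_le measurable_const (hf.measurable.pow_const 2)
  have hκV : 0 < κ * V := by positivity
  have hpt : ∀ ω, f ω ^ 2 ≤ V / 2 + (1 / (4 * (κ * V)) * f ω ^ 4
      + κ * V * A.indicator (fun _ => (1 : ℝ)) ω) := by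
    intro ω
    by_cases hω : ω ∈ A
    · simp only [Set.indicator_of_mem hω]
      have : 1 / (4 * (κ * V)) * f ω ^ 4 + κ * V * 1 - f ω ^ 2
          = (f ω ^ 2 - 2 * (κ * V)) ^ 2 / (4 * (κ * V)) := by
        field_simp; ring
      have h0 : 0 ≤ (f ω ^ 2 - 2 * (κ * V)) ^ 2 / (4 * (κ * V)) := by positivity
      linarith
    · simp only [Set.indicator_of_notMem hω]
      have h1 : f ω ^ 2 < V / 2 := not_le.1 hω
      have : 0 ≤ 1 / (4 * (κ * V)) * f ω ^ 4 := by positivity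
      linarith
  have hI : Integrable (A.indicator (fun _ => (1 : ℝ))) μ := (integrable_const 1).indicator hAm
  have hint2 : Integrable (fun ω => 1 / (4 * (κ * V)) * f ω ^ 4
      + κ * V * A.indicator (fun _ => (1 : ℝ)) ω) μ :=
    ((hf.integrable_pow 4).const_mul _).add (hI.const_mul _)
  have h := integral_mono (hf.integrable_pow 2) ((integrable_const (V / 2)).add hint2) hpt
  simp only [Pi.add_apply] at h
  rw [h2, integral_add (integrable_const _) hint2,
    integral_add ((hf.integrable_pow 4).const_mul _) (hI.const_mul _), integral_const_mul,
    integral_const_mul, integral_indicator_const _ hAm] at h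
  simp only [integral_const, probReal_univ, smul_eq_mul, one_mul, mul_one] at h
  have h5 : 1 / (4 * (κ * V)) * ∫ ω, f ω ^ 4 ∂μ ≤ V / 4 := by
    calc _ ≤ 1 / (4 * (κ * V)) * (κ * V ^ 2) := mul_le_mul_of_nonneg_left h4 (by positivity)
      _ = V / 4 := by field_simp
  have h6 : V / 4 ≤ κ * V * μ.real A := by linarith
  rw [div_le_iff₀ (by positivity)]
  have : V * 1 ≤ V * (μ.real A * (4 * κ)) := by linarith
  exact le_of_mul_le_mul_left this hV

end FiniteMoments

section Multilinear

variable {n : ℕ}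

/-- The multilinear polynomial with coefficients `a` restricted to monomials supported in `s`. -/
def mlOn (s : Finset (Fin n)) (a : Finset (Fin n) → ℝ) (x : Fin n → ℝ) : ℝ :=
  ∑ I ∈ s.powerset, a I * ∏ i ∈ I, x i

lemma mlOn_univ (a : Finset (Fin n) → ℝ) (x : Fin n → ℝ) : mlOn univ a x = mlEval a x := by
  simp [mlOn, mlEval]

lemma mlOn_insert {s : Finset (Fin n)} {i : Fin n} (hi : i ∉ s) (a : Finset (Fin n) → ℝ)
    (x : Fin n → ℝ) :
    mlOn (insert i s) a x = mlOn s a x + x i * mlOn s (fun I => a (insert i I)) x := by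
  simp only [mlOn, sum_powerset_insert hi, mul_sum]
  congr 1
  refine sum_congr rfl fun I hI => ?_
  rw [prod_insert fun h => hi (mem_powerset.1 hI h)]
  ring

lemma dependsOn_mlOn (s : Finset (Fin n)) (a : Finset (Fin n) → ℝ) :
    DependsOn (mlOn s a) (s : Set (Fin n)) := by
  intro x y h
  refine sum_congr rfl fun I hI => ?_
  rw [prod_congr rfl fun i hi => h i (mem_powerset.1 hI hi)]

lemma measurable_mlOn (s : Finset (Fin n)) (a : Finset (Fin n) → ℝ) : Measurable (mlOn s a) := by
  unfold mlOn; fun_prop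

/-- The `k`-th moment of the standard Gaussian. -/
def gaussMoment (k : ℕ) : ℝ := ∫ x, x ^ k ∂gaussianReal 0 1

lemma gaussMoment_even_nonneg (k : ℕ) : 0 ≤ gaussMoment (2 * k) :=
  integral_nonneg fun x => by simp only [pow_mul, Pi.zero_apply]; positivity

variable {Ω : Type*} [MeasurableSpace Ω] {μ : Measure Ω}

/-- Independent standardised variables with vanishing odd moments and controlled even moments. -/
structure IsStandard (z : Fin n → Ω → ℝ) (μ : Measure Ω) : Prop where
  indep : iIndepFun z μ
  finiteMoments : ∀ i, FiniteMoments (z i) μ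
  odd_moment : ∀ i k, Odd k → ∫ ω, z i ω ^ k ∂μ = 0
  second_moment : ∀ i, ∫ ω, z i ω ^ 2 ∂μ = 1
  even_moment : ∀ i k, ∫ ω, z i ω ^ (2 * k) ∂μ ≤ 1 + gaussMoment (2 * k)

/-- A constant in the hypercontractive inequality for the `2q`-th moment. -/
def hyperConst (q : ℕ) : ℝ :=
  1 + ∑ j ∈ range (q + 1), ((2 * q).choose (2 * j) : ℝ) * (1 + gaussMoment (2 * j))

lemma one_le_hyperConst (q : ℕ) : 1 ≤ hyperConst q :=
  le_add_of_nonneg_right <| sum_nonneg fun j _ =>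
    mul_nonneg (by positivity) (by linarith [gaussMoment_even_nonneg j])

lemma sum_range_even_of_odd_eq_zero (f : ℕ → ℝ) (hf : ∀ k, Odd k → f k = 0) (q : ℕ) :
    ∑ m ∈ range (2 * q + 1), f m = ∑ j ∈ range (q + 1), f (2 * j) := by
  induction q with
  | zero => simp
  | succ q ih =>
    rw [show 2 * (q + 1) + 1 = 2 * q + 1 + 1 + 1 by ring, sum_range_succ, sum_range_succ, ih,
      sum_range_succ _ (q + 1), hf (2 * q + 1) ⟨q, rfl⟩, add_zero]
    rfl

namespace IsStandard

variable {z : Fin n → Ω → ℝ}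

lemma integral_mul_of_dependsOn (hz : IsStandard z μ) {s : Finset (Fin n)} {i : Fin n}
    (hi : i ∉ s)
    {G : (Fin n → ℝ) → ℝ} (hG : Measurable G) (hGs : DependsOn G (s : Set (Fin n)))
    {H : ℝ → ℝ} (hH : Measurable H) :
    ∫ ω, G (fun j => z j ω) * H (z i ω) ∂μ
      = (∫ ω, G (fun j => z j ω) ∂μ) * ∫ ω, H (z i ω) ∂μ := by
  have hm : ∀ j, Measurable (z j) := fun j => (hz.finiteMoments j).measurable
  have hind := hz.indep.indepFun_finset s {i} (by simpa using hi) hm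
  let e : (s → ℝ) → Fin n → ℝ := fun v j => if h : j ∈ s then v ⟨j, h⟩ else 0
  have he : Measurable e := by
    refine measurable_pi_lambda _ fun j => ?_
    by_cases h : j ∈ s
    · simp only [e, h, dite_true]; exact measurable_pi_apply _
    · simp only [e, h, dite_false]; exact measurable_const
  have hind2 := hind.comp (φ := fun v => G (e v))
    (ψ := fun v : (({i} : Finset (Fin n)) → ℝ) => H (v ⟨i, mem_singleton_self i⟩))
    (hG.comp he) (hH.comp (measurable_pi_apply _))
  have e1 : ∀ ω, G (e fun j : s => z j ω) = G (fun j => z j ω) := fun ω =>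
    hGs fun j hj => by
      have hj' : j ∈ s := hj
      simp [e, hj']
  have hzm : Measurable fun ω => fun j => z j ω := measurable_pi_lambda _ hm
  have := hind2.integral_fun_mul_eq_mul_integral
    ((hG.comp he).comp (measurable_pi_lambda _ fun j => hm j)).aestronglyMeasurable
    (hH.comp (hm i)).aestronglyMeasurable
  simpa only [Function.comp_def, e1] using this

variable [IsProbabilityMeasure μ]

lemma finiteMoments_mlOn (hz : IsStandard z μ) (s : Finset (Fin n)) (a : Finset (Fin n) → ℝ) :
    FiniteMoments (fun ω => mlOn s a (fun j => z j ω)) μ :=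
  FiniteMoments.sum _ fun I _ => (FiniteMoments.prod I fun i _ => hz.finiteMoments i).const_mul _

lemma choose_mul_moment_le (hz : IsStandard z μ) {q j : ℕ} (hj : j ≤ q) (i : Fin n) :
    ((2 * q).choose (2 * j) : ℝ) * ∫ ω, z i ω ^ (2 * j) ∂μ ≤ (q.choose j : ℝ) * hyperConst q ^ j := by
  rcases Nat.eq_zero_or_pos j with rfl | hj0
  · simp
  have hK := one_le_hyperConst q
  have h1 : ((2 * q).choose (2 * j) : ℝ) * (1 + gaussMoment (2 * j)) ≤ hyperConst q := by
    have := single_le_sum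
      (f := fun j => ((2 * q).choose (2 * j) : ℝ) * (1 + gaussMoment (2 * j)))
      (fun j _ => mul_nonneg (by positivity) (by linarith [gaussMoment_even_nonneg j]))
      (mem_range.2 (Nat.lt_succ_of_le hj))
    unfold hyperConst
    linarith
  have h2 : (1 : ℝ) ≤ q.choose j := by exact_mod_cast Nat.choose_pos hj
  calc _ ≤ ((2 * q).choose (2 * j) : ℝ) * (1 + gaussMoment (2 * j)) :=
        mul_le_mul_of_nonneg_left (hz.even_moment i j) (by positivity)
    _ ≤ hyperConst q := h1
    _ ≤ hyperConst q ^ j := le_self_pow₀ hK hj0.ne'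
    _ ≤ _ := le_mul_of_one_le_left (by positivity) h2

/-- The hypercontractive inequality for multilinear polynomials. -/
lemma integral_mlOn_pow_le (hz : IsStandard z μ) (q : ℕ) (s : Finset (Fin n))
    (a : Finset (Fin n) → ℝ) :
    ∫ ω, mlOn s a (fun j => z j ω) ^ (2 * q) ∂μ
      ≤ (∑ I ∈ s.powerset, hyperConst q ^ I.card * a I ^ 2) ^ q := by
  have hK := one_le_hyperConst q
  induction s using Finset.induction_on generalizing a with
  | empty => simp [mlOn, pow_mul]
  | insert i s hi ih =>
    set K := hyperConst q
    set A := ∑ I ∈ s.powerset, K ^ I.card * a I ^ 2 with hA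
    set B := ∑ I ∈ s.powerset, K ^ I.card * a (insert i I) ^ 2 with hB
    have hA0 : 0 ≤ A := sum_nonneg fun I _ => by positivity
    have hB0 : 0 ≤ B := sum_nonneg fun I _ => by positivity
    have hsum : ∑ I ∈ (insert i s).powerset, K ^ I.card * a I ^ 2 = K * B + A := by
      rw [sum_powerset_insert hi, hB, mul_sum, add_comm]
      congr 1
      refine sum_congr rfl fun I hI => ?_
      rw [card_insert_of_notMem fun h => hi (mem_powerset.1 hI h)]
      ring
    rw [hsum]
    set f := fun ω => mlOn s a (fun j => z j ω) with hf
    set g := fun ω => mlOn s (fun I => a (insert i I)) (fun j => z j ω) with hg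
    have hfM : FiniteMoments f μ := hz.finiteMoments_mlOn s _
    have hgM : FiniteMoments g μ := hz.finiteMoments_mlOn s _
    have hsplit : ∀ m k : ℕ, ∫ ω, g ω ^ m * f ω ^ k * z i ω ^ m ∂μ
        = (∫ ω, g ω ^ m * f ω ^ k ∂μ) * ∫ ω, z i ω ^ m ∂μ := fun m k =>
      hz.integral_mul_of_dependsOn hi
        (G := fun x => mlOn s (fun I => a (insert i I)) x ^ m * mlOn s a x ^ k)
        (((measurable_mlOn _ _).pow_const _).mul ((measurable_mlOn _ _).pow_const _))
        (fun x y h => by simp only [dependsOn_mlOn s _ h]) (H := fun t => t ^ m)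
        (measurable_id.pow_const m)
    have hexp : ∀ ω, mlOn (insert i s) a (fun j => z j ω) ^ (2 * q) =
        ∑ m ∈ range (2 * q + 1),
          ((2 * q).choose m : ℝ) * (g ω ^ m * f ω ^ (2 * q - m) * z i ω ^ m) := by
      intro ω
      rw [mlOn_insert hi, add_comm, add_pow]
      refine sum_congr rfl fun m _ => ?_
      simp only [hf, hg]
      ring
    simp_rw [hexp]
    rw [integral_finsetSum _ fun m _ => ((((hgM.pow m).mul (hfM.pow _)).mul
      ((hz.finiteMoments i).pow m)).integrable).const_mul _]
    simp_rw [integral_const_mul, hsplit]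
    rw [sum_range_even_of_odd_eq_zero _ fun k hk => by rw [hz.odd_moment i k hk]; ring, add_pow]
    refine sum_le_sum fun j hj => ?_
    have hjq : j ≤ q := by simpa [Nat.lt_succ_iff] using hj
    have hmix : ∫ ω, g ω ^ (2 * j) * f ω ^ (2 * q - 2 * j) ∂μ ≤ B ^ j * A ^ (q - j) := by
      have := integral_pow_mul_pow_le (hgM.pow 2) (hfM.pow 2) (fun ω => sq_nonneg _)
        (fun ω => sq_nonneg _) hB0 hA0 hjq (by simpa only [← pow_mul] using ih _)
        (by simpa only [← pow_mul] using ih _)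
      simpa only [← pow_mul, Nat.mul_sub] using this
    have hmom0 : 0 ≤ ∫ ω, z i ω ^ (2 * j) ∂μ :=
      integral_nonneg fun ω => by simp only [pow_mul, Pi.zero_apply]; positivity
    calc _ = (∫ ω, g ω ^ (2 * j) * f ω ^ (2 * q - 2 * j) ∂μ) *
          (((2 * q).choose (2 * j) : ℝ) * ∫ ω, z i ω ^ (2 * j) ∂μ) := by ring
      _ ≤ (B ^ j * A ^ (q - j)) * ((q.choose j : ℝ) * K ^ j) :=
        mul_le_mul hmix (hz.choose_mul_moment_le hjq i) (by positivity) (by positivity)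
      _ = _ := by ring

lemma integral_mlOn_sq (hz : IsStandard z μ) (s : Finset (Fin n)) (a : Finset (Fin n) → ℝ) :
    ∫ ω, mlOn s a (fun j => z j ω) ^ 2 ∂μ = ∑ I ∈ s.powerset, a I ^ 2 := by
  induction s using Finset.induction_on generalizing a with
  | empty => simp [mlOn]
  | insert i s hi ih =>
    have hfM := hz.finiteMoments_mlOn s a
    have hgM := hz.finiteMoments_mlOn s fun I => a (insert i I)
    have hsplit : ∀ (G : (Fin n → ℝ) → ℝ) (m : ℕ), Measurable G → DependsOn G (s : Set (Fin n)) →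
        ∫ ω, G (fun j => z j ω) * z i ω ^ m ∂μ
          = (∫ ω, G (fun j => z j ω) ∂μ) * ∫ ω, z i ω ^ m ∂μ := fun G m hG hGs =>
      hz.integral_mul_of_dependsOn hi hG hGs (measurable_id.pow_const m)
    have hexp : ∀ ω, mlOn (insert i s) a (fun j => z j ω) ^ 2 =
        mlOn s a (fun j => z j ω) ^ 2
        + 2 * (mlOn s a (fun j => z j ω) * mlOn s (fun I => a (insert i I)) (fun j => z j ω)
          * z i ω ^ 1)
        + mlOn s (fun I => a (insert i I)) (fun j => z j ω) ^ 2 * z i ω ^ 2 := by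
      intro ω
      rw [mlOn_insert hi]; ring
    simp_rw [hexp]
    rw [integral_add, integral_add, integral_const_mul,
      hsplit (fun x => mlOn s a x * mlOn s (fun I => a (insert i I)) x) 1
        ((measurable_mlOn _ _).mul (measurable_mlOn _ _))
        (fun x y h => by simp only [dependsOn_mlOn s _ h]),
      hsplit (fun x => mlOn s (fun I => a (insert i I)) x ^ 2) 2
        ((measurable_mlOn _ _).pow_const 2) (fun x y h => by simp only [dependsOn_mlOn s _ h]),
      hz.odd_moment i 1 odd_one, hz.second_moment i, ih, ih, sum_powerset_insert hi]
    · ring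
    · exact hfM.integrable_pow 2
    · exact ((hfM.mul hgM).mul ((hz.finiteMoments i).pow 1)).integrable.const_mul 2
    · exact (hfM.integrable_pow 2).add
        (((hfM.mul hgM).mul ((hz.finiteMoments i).pow 1)).integrable.const_mul 2)
    · exact ((hgM.pow 2).mul ((hz.finiteMoments i).pow 2)).integrable

end IsStandard

end Multilinear

section GaussianSpace

variable {n : ℕ}

lemma isStandard_pi {E : Type*} [MeasurableSpace E] {ν : Measure E} [IsProbabilityMeasure ν]
    {h : Fin n → E → ℝ} (hfin : ∀ i, FiniteMoments (h i) ν)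
    (hodd : ∀ i k, Odd k → ∫ x, h i x ^ k ∂ν = 0) (htwo : ∀ i, ∫ x, h i x ^ 2 ∂ν = 1)
    (heven : ∀ i k, ∫ x, h i x ^ (2 * k) ∂ν ≤ 1 + gaussMoment (2 * k)) :
    IsStandard (fun i (ω : Fin n → E) => h i (ω i)) (Measure.pi fun _ => ν) := by
  have hmp := fun i : Fin n => measurePreserving_eval (fun _ : Fin n => ν) i
  have hint : ∀ i k, ∫ ω : Fin n → E, h i (ω i) ^ k ∂(Measure.pi fun _ => ν)
      = ∫ x, h i x ^ k ∂ν := by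
    intro i k
    have := integral_map (μ := Measure.pi fun _ : Fin n => ν) (hmp i).measurable.aemeasurable
      (f := fun x => h i x ^ k) ((hfin i).measurable.pow_const k).aestronglyMeasurable
    rw [(hmp i).map_eq] at this
    exact this.symm
  refine ⟨iIndepFun_pi fun i => (hfin i).measurable.aemeasurable, fun i => ⟨(hfin i).measurable.comp
    (measurable_pi_apply i), fun p => ?_⟩, fun i k hk => ?_, fun i => ?_, fun i k => ?_⟩
  · exact (hmp i).integrable_comp_of_integrable ((hfin i).integrable_abs_pow p)
  · rw [hint, hodd i k hk]
  · rw [hint, htwo]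
  · rw [hint]; exact heven i k

lemma finiteMoments_gaussianReal : FiniteMoments (fun x : ℝ => x) (gaussianReal 0 1) :=
  ⟨measurable_id, fun p => by
    simpa using (memLp_id_gaussianReal (μ := 0) (v := 1) p).integrable_norm_pow'⟩

lemma gaussMoment_odd {k : ℕ} (hk : Odd k) : gaussMoment k = 0 := by
  have h := gaussianReal_map_neg (μ := 0) (v := 1)
  rw [neg_zero] at h
  have h2 : gaussMoment k = -gaussMoment k := by
    conv_lhs => rw [gaussMoment, ← h]
    rw [integral_map (by fun_prop) (by fun_prop)]
    simp only [hk.neg_pow, integral_neg, gaussMoment]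
  linarith

lemma gaussMoment_two : gaussMoment 2 = 1 := by
  have h := variance_fun_id_gaussianReal (μ := 0) (v := 1)
  rw [variance_eq_integral (by fun_prop)] at h
  simpa [integral_id_gaussianReal, gaussMoment] using h

lemma isStandard_gaussn : IsStandard (fun i (x : Fin n → ℝ) => x i) (gaussn n) :=
  isStandard_pi (h := fun _ x => x) (fun _ => finiteMoments_gaussianReal)
    (fun _ _ hk => gaussMoment_odd hk) (fun _ => gaussMoment_two)
    fun _ k => by rw [← gaussMoment]; linarith

instance : IsProbabilityMeasure (gaussn n) := by unfold gaussn; infer_instance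

instance : IsGaussian (gaussn n) := by
  have h := (iIndepFun_pi (μ := fun _ : Fin n => gaussianReal 0 1) (X := fun _ x => x)
    fun _ => aemeasurable_id)
  have h2 := h.hasGaussianLaw fun i => ⟨by
    rw [(measurePreserving_eval (fun _ : Fin n => gaussianReal 0 1) i).map_eq]; infer_instance⟩
  have h3 := h2.isGaussian_map
  rwa [Measure.map_id'] at h3

lemma measurePreserving_rotation (θ : ℝ) :
    MeasurePreserving (ContinuousLinearMap.rotation (E := Fin n → ℝ) θ)
      ((gaussn n).prod (gaussn n)) ((gaussn n).prod (gaussn n)) := by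
  refine ⟨by fun_prop, IsGaussian.map_rotation_eq_self ?_ θ⟩
  ext i
  have := (isStandard_gaussn (n := n)).odd_moment i 1 odd_one
  simp only [pow_one] at this
  rw [eval_integral]
  · exact this
  · exact fun i => (isStandard_gaussn.finiteMoments i).integrable

end GaussianSpace

section Circle

open Polynomial in
lemma norm_eval_le_two_pow_mul {Q : ℂ[X]} {N : ℕ} (hN : Q.natDegree ≤ N) {z w : ℂ}
    (h : ∀ r ∈ Q.roots, ‖w - z‖ ≤ ‖z - r‖) : ‖Q.eval w‖ ≤ 2 ^ N * ‖Q.eval z‖ := by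
  have hs := IsAlgClosed.splits Q
  have key : ∀ m : Multiset ℂ, (∀ r ∈ m, ‖w - z‖ ≤ ‖z - r‖) →
      ‖(m.map (fun r => w - r)).prod‖ ≤ 2 ^ Multiset.card m * ‖(m.map (fun r => z - r)).prod‖ := by
    intro m
    induction m using Multiset.induction with
    | empty => simp
    | cons r m ih =>
      intro hm
      have h1 := ih fun r hr => hm r (Multiset.mem_cons_of_mem hr)
      have h2 := hm r (Multiset.mem_cons_self r m)
      have h3 : ‖w - r‖ ≤ 2 * ‖z - r‖ := by
        have := norm_add_le (w - z) (z - r)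
        rw [sub_add_sub_cancel] at this
        linarith
      simp only [Multiset.map_cons, Multiset.prod_cons, norm_mul, Multiset.card_cons]
      calc _ ≤ (2 * ‖z - r‖) * (2 ^ Multiset.card m * ‖(m.map (fun r => z - r)).prod‖) := by gcongr
        _ = _ := by ring
  rw [hs.eval_eq_prod_roots, hs.eval_eq_prod_roots, norm_mul, norm_mul]
  have h1 := key _ h
  have h2 : (2 : ℝ) ^ Multiset.card Q.roots ≤ 2 ^ N :=
    pow_le_pow_right₀ (by norm_num) ((card_roots' Q).trans hN)
  calc _ ≤ ‖Q.leadingCoeff‖ * (2 ^ N * ‖(Q.roots.map (fun r => z - r)).prod‖) := by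
        gcongr; exact h1.trans (by gcongr)
    _ = _ := by ring

lemma norm_exp_sub_exp (φ ψ : ℝ) : ‖Complex.exp (Complex.I * φ) - Complex.exp (Complex.I * ψ)‖
    = 2 * |Real.sin ((φ - ψ) / 2)| := by
  have h : Complex.exp (Complex.I * φ) - Complex.exp (Complex.I * ψ)
      = Complex.exp (Complex.I * ψ) * (Complex.exp (Complex.I * ((φ - ψ : ℝ) : ℂ)) - 1) := by
    rw [mul_sub, ← Complex.exp_add]; push_cast; ring_nf
  rw [h, norm_mul, Complex.norm_exp_I_mul_ofReal, Complex.norm_exp_I_mul_ofReal_sub_one, one_mul]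
  simp

lemma volume_arc_le (r : ℂ) (τ : ℝ) :
    volume {φ : ℝ | φ ∈ Set.Icc 0 1 ∧ ‖Complex.exp (Complex.I * φ) - r‖ < τ}
      ≤ ENNReal.ofReal (Real.pi * τ) := by
  refine (Real.volume_le_diam _).trans (Metric.ediam_le fun φ hφ ψ hψ => ?_)
  rw [edist_dist]
  refine ENNReal.ofReal_le_ofReal ?_
  obtain ⟨⟨h1, h2⟩, h3⟩ := hφ
  obtain ⟨⟨h4, h5⟩, h6⟩ := hψ
  have h7 : ‖Complex.exp (Complex.I * φ) - Complex.exp (Complex.I * ψ)‖ ≤ 2 * τ := by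
    have := norm_sub_le (Complex.exp (Complex.I * φ) - r) (Complex.exp (Complex.I * ψ) - r)
    rw [sub_sub_sub_cancel_right] at this
    linarith
  rw [norm_exp_sub_exp] at h7
  have h8 : 2 / Real.pi * (|φ - ψ| / 2) ≤ |Real.sin ((φ - ψ) / 2)| := by
    have h9 : |φ - ψ| ≤ 1 := by rw [abs_le]; constructor <;> linarith
    have := Real.mul_le_sin (x := |φ - ψ| / 2) (by positivity) (by linarith [Real.pi_gt_three])
    refine this.trans ?_
    rcases abs_cases (φ - ψ) with h | h <;> rw [h.1]
    · exact le_abs_self _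
    · rw [neg_div, Real.sin_neg]; exact neg_le_abs _
  rw [Real.dist_eq]
  have hpi := Real.pi_pos
  have h9 : 2 / Real.pi * (|φ - ψ| / 2) = |φ - ψ| / Real.pi := by ring
  rw [h9, div_le_iff₀ hpi] at h8
  nlinarith

open Polynomial in
lemma volume_circle_growth_le {Q : ℂ[X]} {N : ℕ} (hN : Q.natDegree ≤ N) {τ : ℝ} (hτ : 0 ≤ τ) :
    volume {φ : ℝ | φ ∈ Set.Icc 0 1 ∧ 2 ^ N * ‖Q.eval (Complex.exp (Complex.I * φ))‖
      < ‖Q.eval (Complex.exp (Complex.I * (φ + τ : ℝ)))‖} ≤ ENNReal.ofReal (N * (Real.pi * τ)) := by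
  have hsub : {φ : ℝ | φ ∈ Set.Icc 0 1 ∧ 2 ^ N * ‖Q.eval (Complex.exp (Complex.I * φ))‖
      < ‖Q.eval (Complex.exp (Complex.I * (φ + τ : ℝ)))‖} ⊆ ⋃ r ∈ Q.roots.toFinset,
        {φ : ℝ | φ ∈ Set.Icc 0 1 ∧ ‖Complex.exp (Complex.I * φ) - r‖ < τ} := by
    rintro φ ⟨h1, h2⟩
    simp only [Set.mem_iUnion, Multiset.mem_toFinset]
    by_contra! hcon
    refine absurd (norm_eval_le_two_pow_mul hN (z := Complex.exp (Complex.I * φ))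
      (w := Complex.exp (Complex.I * (φ + τ : ℝ))) fun r hr => ?_) (not_le.2 h2)
    have h3 : τ ≤ ‖Complex.exp (Complex.I * φ) - r‖ := by
      by_contra! h4; exact hcon r hr ⟨h1, h4⟩
    refine le_trans ?_ h3
    rw [norm_exp_sub_exp, add_sub_cancel_left]
    have := Real.abs_sin_le_abs (x := τ / 2)
    rw [abs_of_nonneg (by positivity : 0 ≤ τ / 2)] at this
    linarith
  refine (measure_mono hsub).trans ((measure_biUnion_finset_le _ _).trans ?_)
  refine (Finset.sum_le_sum fun r _ => volume_arc_le r τ).trans ?_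
  rw [Finset.sum_const, nsmul_eq_mul, ENNReal.ofReal_mul (p := (N : ℝ)) (by positivity),
    ENNReal.ofReal_natCast]
  gcongr
  exact (Multiset.toFinset_card_le _).trans ((card_roots' Q).trans hN)

variable {n : ℕ}

open Polynomial in
/-- On the unit circle, `circlePoly d a x y` agrees in modulus with the restriction of `a` to the
circle through `x` and `y`. -/
def circlePoly (d : ℕ) (a : Finset (Fin n) → ℝ) (x y : Fin n → ℝ) : ℂ[X] :=
  ∑ T : Finset (Fin n), C (a T : ℂ) * X ^ (d - T.card) *
    ∏ i ∈ T, (C ((x i - Complex.I * y i) / 2) * X ^ 2 + C ((x i + Complex.I * y i) / 2))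

open Polynomial in
lemma natDegree_circlePoly_le {d : ℕ} {a : Finset (Fin n) → ℝ} (ha : DegLE a d)
    (x y : Fin n → ℝ) : (circlePoly d a x y).natDegree ≤ 2 * d := by
  refine natDegree_sum_le_of_forall_le _ _ fun T _ => ?_
  by_cases hT : a T = 0
  · simp [hT]
  have hc := ha T hT
  refine natDegree_mul_le.trans ?_
  have h1 := natDegree_C_mul_X_pow_le (a T : ℂ) (d - T.card)
  have h2 : (∏ i ∈ T, (C ((x i - Complex.I * y i) / 2) * X ^ 2
      + C ((x i + Complex.I * y i) / 2) : ℂ[X])).natDegree ≤ 2 * T.card := by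
    refine (natDegree_prod_le _ _).trans ?_
    rw [mul_comm, ← smul_eq_mul]
    refine Finset.sum_le_card_nsmul _ _ _ fun i _ => ?_
    compute_degree
  omega

lemma norm_eval_circlePoly {d : ℕ} {a : Finset (Fin n) → ℝ} (ha : DegLE a d)
    (x y : Fin n → ℝ) (φ : ℝ) :
    ‖(circlePoly d a x y).eval (Complex.exp (Complex.I * φ))‖
      = |mlEval a (Real.cos φ • x + Real.sin φ • y)| := by
  have h : (circlePoly d a x y).eval (Complex.exp (Complex.I * φ))
      = Complex.exp (Complex.I * φ) ^ d * (mlEval a (Real.cos φ • x + Real.sin φ • y) : ℂ) := by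
    simp only [circlePoly, mlEval, Polynomial.eval_finsetSum, Polynomial.eval_mul,
      Polynomial.eval_C, Polynomial.eval_pow, Polynomial.eval_X, Polynomial.eval_prod,
      Polynomial.eval_add]
    push_cast
    rw [Finset.mul_sum]
    refine Finset.sum_congr rfl fun T _ => ?_
    by_cases hT : a T = 0
    · simp [hT]
    have hc := ha T hT
    have h1 : ∀ i, (((x i : ℂ) - Complex.I * y i) / 2) * Complex.exp (Complex.I * φ) ^ 2
        + (x i + Complex.I * y i) / 2 = Complex.exp (Complex.I * φ) *
          ((Real.cos φ • x + Real.sin φ • y) i : ℝ) := by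
      intro i
      have h2 : Complex.exp (Complex.I * φ) = Complex.cos φ + Complex.sin φ * Complex.I := by
        rw [mul_comm, Complex.exp_mul_I]
      have h3 := Complex.sin_sq_add_cos_sq φ
      simp only [Pi.add_apply, Pi.smul_apply, smul_eq_mul]
      push_cast
      rw [h2]
      linear_combination ((x i : ℂ) - Complex.I * y i) / 2 * (Complex.sin φ ^ 2 * Complex.I_sq)
        - (x i + Complex.I * y i) / 2 * h3 - y i * Complex.cos φ * Complex.sin φ * Complex.I_sq
    simp only [h1, Finset.prod_mul_distrib, Finset.prod_const]
    rw [← Nat.sub_add_cancel hc, pow_add, Nat.add_sub_cancel]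
    ring
  rw [h, norm_mul, norm_pow, Complex.norm_exp_I_mul_ofReal, one_pow, one_mul, Complex.norm_real,
    Real.norm_eq_abs]


lemma continuous_mlEval (a : Finset (Fin n) → ℝ) : Continuous (mlEval a) := by
  unfold mlEval; fun_prop

lemma gaussn_prod_rotation_growth_le {d : ℕ} {a : Finset (Fin n) → ℝ} (ha : DegLE a d) {τ : ℝ}
    (hτ : 0 ≤ τ) : ((gaussn n).prod (gaussn n))
      {p | 2 ^ (2 * d) * |mlEval a p.1| < |mlEval a (Real.cos τ • p.1 + Real.sin τ • p.2)|}
      ≤ ENNReal.ofReal (2 * d * (Real.pi * τ)) := by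
  set μ := (gaussn n).prod (gaussn n)
  set A : Set ((Fin n → ℝ) × (Fin n → ℝ)) :=
    {p | 2 ^ (2 * d) * |mlEval a p.1| < |mlEval a (Real.cos τ • p.1 + Real.sin τ • p.2)|} with hA
  have hml := continuous_mlEval a
  have hAm : MeasurableSet A := measurableSet_lt (by fun_prop) (by fun_prop)
  set S : Set (ℝ × ((Fin n → ℝ) × (Fin n → ℝ))) :=
    {q | 2 ^ (2 * d) * |mlEval a (Real.cos q.1 • q.2.1 + Real.sin q.1 • q.2.2)|
      < |mlEval a (Real.cos (q.1 + τ) • q.2.1 + Real.sin (q.1 + τ) • q.2.2)|} with hS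
  have hSm : MeasurableSet S := measurableSet_lt (by fun_prop) (by fun_prop)
  have hrot : ∀ φ : ℝ, μ (Prod.mk φ ⁻¹' S) = μ A := by
    intro φ
    rw [← (measurePreserving_rotation φ).measure_preimage hAm.nullMeasurableSet]
    congr 1
    ext p
    simp only [hA, hS, Set.mem_preimage, Set.mem_ofPred_eq, ContinuousLinearMap.rotation_apply]
    have : Real.cos (φ + τ) • p.1 + Real.sin (φ + τ) • p.2
        = Real.cos τ • (Real.cos φ • p.1 + Real.sin φ • p.2)
          + Real.sin τ • (-Real.sin φ • p.1 + Real.cos φ • p.2) := by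
      rw [Real.cos_add, Real.sin_add]
      module
    rw [this]
  set l : Measure ℝ := volume.restrict (Set.Icc 0 1) with hl
  have h1 : (l.prod μ) S = μ A := by
    rw [Measure.prod_apply hSm]
    simp [hrot, hl]
  rw [← h1, Measure.prod_apply_symm hSm]
  calc ∫⁻ p, l ((fun φ => (φ, p)) ⁻¹' S) ∂μ
      ≤ ∫⁻ _, ENNReal.ofReal (2 * d * (Real.pi * τ)) ∂μ := by
        refine lintegral_mono fun p => ?_
        have h2 := volume_circle_growth_le (natDegree_circlePoly_le ha p.1 p.2) hτ
        push_cast at h2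
        refine le_trans (le_of_eq ?_) h2
        rw [hl, Measure.restrict_apply (measurable_prodMk_right hSm)]
        congr 1
        ext φ
        simp only [hS, Set.mem_inter_iff, Set.mem_preimage, Set.mem_ofPred_eq,
          ← norm_eval_circlePoly ha, ← Complex.ofReal_add]
        exact and_comm
    _ = _ := by simp [μ]

end Circle

section Expansion

variable {n : ℕ}

lemma sum_powerset_compl_comm {M : Type*} [AddCommMonoid M]
    (F : Finset (Fin n) → Finset (Fin n) → M) :
    ∑ S : Finset (Fin n), ∑ J ∈ Sᶜ.powerset, F S J
      = ∑ T : Finset (Fin n), ∑ S ∈ T.powerset, F S (T \ S) := by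
  rw [sum_sigma', sum_sigma']
  refine sum_nbij' (fun p => ⟨p.1 ∪ p.2, p.1⟩) (fun p => ⟨p.2, p.1 \ p.2⟩) ?_ ?_ ?_ ?_ ?_
  · rintro ⟨S, J⟩ _
    simp only [mem_sigma, mem_univ, mem_powerset, true_and]
    exact subset_union_left
  · rintro ⟨T, S⟩ h
    simp only [mem_sigma, mem_univ, mem_powerset, true_and] at h ⊢
    exact fun i hi => by simp_all
  · rintro ⟨S, J⟩ h
    simp only [mem_sigma, mem_univ, mem_powerset, true_and] at h ⊢
    rw [union_sdiff_cancel_left (disjoint_left.2 fun i hi hj => (mem_compl.1 (h hj)) hi)]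
  · rintro ⟨T, S⟩ h
    simp only [mem_sigma, mem_univ, mem_powerset, true_and] at h ⊢
    rw [union_sdiff_of_subset h]
  · rintro ⟨S, J⟩ h
    simp only [mem_sigma, mem_univ, mem_powerset, true_and] at h ⊢
    rw [union_sdiff_cancel_left (disjoint_left.2 fun i hi hj => (mem_compl.1 (h hj)) hi)]

/-- The coefficients of `y ↦ mlEval a (c • x + s • y)`. -/
def mixCoeff (a : Finset (Fin n) → ℝ) (c s : ℝ) (x : Fin n → ℝ) (S : Finset (Fin n)) : ℝ :=
  s ^ S.card * mlOn Sᶜ (fun J => a (S ∪ J) * c ^ J.card) x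

lemma mlEval_smul_add_smul (a : Finset (Fin n) → ℝ) (c s : ℝ) (x y : Fin n → ℝ) :
    mlEval a (c • x + s • y) = mlEval (mixCoeff a c s x) y := by
  simp only [mlEval, mixCoeff, mlOn, mul_sum, sum_mul]
  rw [sum_powerset_compl_comm]
  refine sum_congr rfl fun T _ => ?_
  have h : ∀ i, (c • x + s • y) i = s * y i + c * x i := fun i => by simp [add_comm]
  simp only [h]
  rw [prod_add, mul_sum]
  refine sum_congr rfl fun S hS => ?_
  rw [union_sdiff_of_subset (mem_powerset.1 hS), prod_mul_distrib, prod_mul_distrib, prod_const,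
    prod_const]
  ring

lemma degLE_mixCoeff {a : Finset (Fin n) → ℝ} {d : ℕ} (ha : DegLE a d) (c s : ℝ)
    (x : Fin n → ℝ) : DegLE (mixCoeff a c s x) d := by
  intro S hS
  by_contra! hlt
  refine hS ?_
  have : ∀ J, a (S ∪ J) = 0 := fun J => by
    by_contra h
    exact absurd ((card_le_card subset_union_left).trans (ha _ h)) (not_le.2 hlt)
  simp [mixCoeff, mlOn, this]

lemma sum_hyperConst_le {a : Finset (Fin n) → ℝ} {d : ℕ} (ha : DegLE a d) (q : ℕ)
    (A : Finset (Finset (Fin n))) :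
    ∑ I ∈ A, hyperConst q ^ I.card * a I ^ 2 ≤ hyperConst q ^ d * ∑ I ∈ A, a I ^ 2 := by
  rw [mul_sum]
  refine sum_le_sum fun I _ => ?_
  by_cases hI : a I = 0
  · simp [hI]
  · gcongr
    · exact one_le_hyperConst q
    · exact ha I hI

lemma gaussn_half_variance_le {b : Finset (Fin n) → ℝ} {d : ℕ} (hb : DegLE b d)
    (hV : 0 < ∑ I, b I ^ 2) : 1 / (4 * hyperConst 2 ^ (2 * d))
      ≤ (gaussn n).real {y | (∑ I, b I ^ 2) / 2 ≤ mlEval b y ^ 2} := by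
  have hz := isStandard_gaussn (n := n)
  simp only [← mlOn_univ]
  have hK := one_le_hyperConst 2
  refine paley_zygmund (hz.finiteMoments_mlOn univ b) hV (by positivity) ?_ ?_
  · simpa using hz.integral_mlOn_sq univ b
  · refine (hz.integral_mlOn_pow_le 2 univ b).trans ?_
    rw [powerset_univ, mul_comm 2 d, pow_mul, ← mul_pow]
    exact pow_le_pow_left₀ (sum_nonneg fun I _ => by positivity) (sum_hyperConst_le hb 2 _) 2

/-- If rotating by `τ` typically makes `mlEval a` large, then `mlEval a` is rarely small. -/
lemma gaussn_small_inter_good_le {a : Finset (Fin n) → ℝ} {d : ℕ} (ha : DegLE a d) {τ δ : ℝ}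
    (hτ : 0 ≤ τ) {G : Set (Fin n → ℝ)} (hG : MeasurableSet G)
    (hsmall : ∀ x ∈ G, |mlEval a x| ≤ δ)
    (hgood : ∀ x ∈ G, (2 ^ (2 * d) * δ) ^ 2
      < (∑ S, mixCoeff a (Real.cos τ) (Real.sin τ) x S ^ 2) / 2) :
    (gaussn n).real G ≤ 4 * hyperConst 2 ^ (2 * d) * (2 * d * (Real.pi * τ)) := by
  have hK := one_le_hyperConst 2
  set κ := hyperConst 2 ^ (2 * d)
  have hκ : 0 < κ := by positivity
  set A : Set ((Fin n → ℝ) × (Fin n → ℝ)) :=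
    {p | 2 ^ (2 * d) * |mlEval a p.1| < |mlEval a (Real.cos τ • p.1 + Real.sin τ • p.2)|} with hA
  have hml := continuous_mlEval a
  have hAm : MeasurableSet A := measurableSet_lt (by fun_prop) (by fun_prop)
  have hslice : ∀ x ∈ G, ENNReal.ofReal (1 / (4 * κ)) ≤ gaussn n (Prod.mk x ⁻¹' A) := by
    intro x hx
    have hlt := hgood x hx
    refine (ENNReal.ofReal_le_ofReal (gaussn_half_variance_le
      (degLE_mixCoeff ha (Real.cos τ) (Real.sin τ) x) ?_)).trans ?_
    · nlinarith [sq_nonneg (2 ^ (2 * d) * δ)]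
    · rw [ofReal_measureReal]
      refine measure_mono fun y hy => ?_
      have hy' := hlt.trans_le hy
      rw [← mlEval_smul_add_smul] at hy'
      have h1 : |2 ^ (2 * d) * δ| < |mlEval a (Real.cos τ • x + Real.sin τ • y)| :=
        sq_lt_sq.1 hy'
      refine lt_of_le_of_lt ?_ h1
      exact (mul_le_mul_of_nonneg_left (hsmall x hx) (by positivity)).trans (le_abs_self _)
  have h1 : ENNReal.ofReal (1 / (4 * κ)) * gaussn n G
      ≤ ENNReal.ofReal (2 * d * (Real.pi * τ)) := by
    refine le_trans ?_ (gaussn_prod_rotation_growth_le ha hτ)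
    rw [Measure.prod_apply hAm, ← setLIntegral_const]
    exact (setLIntegral_mono' hG fun x hx => hslice x hx).trans (setLIntegral_le_lintegral _ _)
  have hpi := Real.pi_pos
  have h2 := ENNReal.toReal_mono ENNReal.ofReal_ne_top h1
  rw [ENNReal.toReal_mul, ENNReal.toReal_ofReal (by positivity),
    ENNReal.toReal_ofReal (by positivity), ← measureReal_def, one_div, inv_mul_le_iff₀
    (by positivity)] at h2
  exact h2

end Expansion

section Levels

variable {n : ℕ}

/-- The squared `ℓ²` mass of the degree-`k` part. -/
def levelWeight (a : Finset (Fin n) → ℝ) (k : ℕ) : ℝ :=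
  ∑ I ∈ univ.filter (fun I : Finset (Fin n) => I.card = k), a I ^ 2

lemma exists_dominant_level {W : ℕ → ℝ} {d : ℕ} {ρ : ℝ} (hρ : 0 < ρ) (hρ1 : ρ ≤ 1)
    (hW : ∑ k ∈ Icc 1 d, W k = 1) :
    ∃ k ∈ Icc 1 d, ρ ^ (k - 1) / d ≤ W k ∧ ∀ j ∈ Icc 1 d, k < j → W j ≤ ρ * W k := by
  have hd : 0 < d := by
    rcases Nat.eq_zero_or_pos d with rfl | h
    · simp at hW
    · exact h
  have hd' : (0 : ℝ) < d := by exact_mod_cast hd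
  set S := (Icc 1 d).filter fun k => ρ ^ (k - 1) / d ≤ W k with hS
  have hne : S.Nonempty := by
    by_contra hemp
    rw [not_nonempty_iff_eq_empty, filter_eq_empty_iff] at hemp
    have h1 : ∑ k ∈ Icc 1 d, W k < ∑ _k ∈ Icc 1 d, 1 / (d : ℝ) := by
      refine sum_lt_sum_of_nonempty (nonempty_Icc.2 hd) fun k hk => ?_
      refine (not_le.1 (hemp hk)).trans_le ?_
      gcongr
      exact pow_le_one₀ hρ.le hρ1
    rw [hW, sum_const, Nat.card_Icc, Nat.add_sub_cancel, nsmul_eq_mul,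
      mul_one_div_cancel hd'.ne'] at h1
    exact lt_irrefl _ h1
  obtain ⟨hk, hkW⟩ := mem_filter.1 (S.max'_mem hne)
  refine ⟨S.max' hne, hk, hkW, fun j hj hkj => ?_⟩
  have hjS : j ∉ S := fun h => absurd (S.le_max' j h) (not_le.2 hkj)
  have hlt : W j < ρ ^ (j - 1) / d := by
    by_contra! h; exact hjS (mem_filter.2 ⟨hj, h⟩)
  set k := S.max' hne
  have hk1 := (mem_Icc.1 hk).1
  calc W j ≤ ρ ^ (j - 1) / d := hlt.le
    _ ≤ ρ ^ (k - 1 + 1) / d := by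
        gcongr ?_ / _
        exact pow_le_pow_of_le_one hρ.le hρ1 (by omega)
    _ = ρ * (ρ ^ (k - 1) / d) := by ring
    _ ≤ ρ * W k := by gcongr

lemma sum_higher_levels_le {a : Finset (Fin n) → ℝ} {d k : ℕ} (ha : DegLE a d) {B : ℝ}
    (hB : 0 ≤ B) (h : ∀ j ∈ Icc 1 d, k < j → levelWeight a j ≤ B) :
    ∑ T : Finset (Fin n), (if k < T.card then a T ^ 2 else 0) ≤ d * B := by
  have h1 : ∀ T : Finset (Fin n), (if k < T.card then a T ^ 2 else 0)
      = ∑ j ∈ Icc 1 d, if k < j then (if T.card = j then a T ^ 2 else 0) else 0 := by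
    intro T
    by_cases hT : a T = 0
    · simp [hT]
    by_cases hk : k < T.card
    · rw [sum_eq_single_of_mem T.card (mem_Icc.2 ⟨by omega, ha T hT⟩)]
      · simp
      · intro j _ hj; simp [Ne.symm hj]
    · rw [if_neg hk]
      refine (sum_eq_zero fun j _ => ?_).symm
      split_ifs with h1 h2
      · omega
      · rfl
      · rfl
  simp_rw [h1]
  rw [sum_comm]
  have h2 : ∀ j ∈ Icc 1 d, ∑ T : Finset (Fin n),
      (if k < j then (if T.card = j then a T ^ 2 else 0) else 0) ≤ B := by
    intro j hj
    by_cases hk : k < j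
    · simp only [hk, if_true, ← sum_filter]
      exact h j hj hk
    · simpa [hk] using hB
  refine (sum_le_card_nsmul _ _ _ h2).trans ?_
  simp

/-- The non-constant part, in the remaining variables, of the coefficient of `∏ i ∈ S, y i`. -/
def tailCoeff (a : Finset (Fin n) → ℝ) (c : ℝ) (S J : Finset (Fin n)) : ℝ :=
  if J = ∅ then 0 else a (S ∪ J) * c ^ J.card

lemma mlOn_eq_add_tail (a : Finset (Fin n) → ℝ) (c : ℝ) (S : Finset (Fin n)) (x : Fin n → ℝ) :
    mlOn Sᶜ (fun J => a (S ∪ J) * c ^ J.card) x = a S + mlOn Sᶜ (tailCoeff a c S) x := by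
  have h1 := add_sum_erase Sᶜ.powerset (fun J => (a (S ∪ J) * c ^ J.card) * ∏ i ∈ J, x i)
    (empty_mem_powerset _)
  have h2 := add_sum_erase Sᶜ.powerset (fun J => tailCoeff a c S J * ∏ i ∈ J, x i)
    (empty_mem_powerset _)
  unfold mlOn
  rw [← h1, ← h2]
  have h3 : ∀ J ∈ Sᶜ.powerset.erase ∅, tailCoeff a c S J = a (S ∪ J) * c ^ J.card :=
    fun J hJ => if_neg (ne_of_mem_erase hJ)
  have h4 : ∑ J ∈ Sᶜ.powerset.erase ∅, tailCoeff a c S J * ∏ i ∈ J, x i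
      = ∑ J ∈ Sᶜ.powerset.erase ∅, a (S ∪ J) * c ^ J.card * ∏ i ∈ J, x i :=
    sum_congr rfl fun J hJ => by rw [h3 J hJ]
  rw [h4]
  simp [show tailCoeff a c S ∅ = 0 from if_pos rfl]

lemma sum_tailCoeff_le {a : Finset (Fin n) → ℝ} {d k : ℕ} (ha : DegLE a d) {c : ℝ}
    (hc : |c| ≤ 1) {B : ℝ} (hB : 0 ≤ B) (h : ∀ j ∈ Icc 1 d, k < j → levelWeight a j ≤ B) :
    ∑ S ∈ univ.filter (fun S : Finset (Fin n) => S.card = k),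
      ∑ J ∈ Sᶜ.powerset, hyperConst d ^ J.card * tailCoeff a c S J ^ 2
      ≤ (2 * hyperConst d) ^ d * (d * B) := by
  have hK := one_le_hyperConst d
  set K := hyperConst d
  have h1 : ∀ S J : Finset (Fin n), K ^ J.card * tailCoeff a c S J ^ 2
      ≤ if J = ∅ then 0 else K ^ d * a (S ∪ J) ^ 2 := by
    intro S J
    unfold tailCoeff
    split_ifs with hJ
    · simp
    by_cases hz : a (S ∪ J) = 0
    · simp [hz]
    have hle : J.card ≤ d := (card_le_card subset_union_right).trans (ha _ hz)
    have hc2 : (c ^ J.card) ^ 2 ≤ 1 := by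
      rw [sq_le_one_iff_abs_le_one, abs_pow]
      exact pow_le_one₀ (abs_nonneg c) hc
    rw [mul_pow]
    calc K ^ J.card * (a (S ∪ J) ^ 2 * (c ^ J.card) ^ 2)
        ≤ K ^ d * (a (S ∪ J) ^ 2 * 1) := by gcongr
      _ = _ := by ring
  have h2 : ∑ S ∈ univ.filter (fun S : Finset (Fin n) => S.card = k),
      ∑ J ∈ Sᶜ.powerset, K ^ J.card * tailCoeff a c S J ^ 2
      ≤ ∑ S : Finset (Fin n), ∑ J ∈ Sᶜ.powerset,
        if S.card = k ∧ J ≠ ∅ then K ^ d * a (S ∪ J) ^ 2 else 0 := by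
    rw [sum_filter]
    refine sum_le_sum fun S _ => ?_
    split_ifs with hS
    · refine sum_le_sum fun J _ => (h1 S J).trans (le_of_eq ?_)
      by_cases hJ : J = ∅ <;> simp [hJ, hS]
    · exact sum_nonneg fun J _ => by split_ifs <;> positivity
  refine h2.trans ?_
  rw [sum_powerset_compl_comm]
  calc _ ≤ ∑ T : Finset (Fin n), (2 * K) ^ d * (if k < T.card then a T ^ 2 else 0) := by
        refine sum_le_sum fun T _ => ?_
        by_cases hT : a T = 0
        · refine le_of_eq ?_
          rw [sum_eq_zero fun S hS => ?_]
          · simp [hT]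
          · rw [union_sdiff_of_subset (mem_powerset.1 hS)]; simp [hT]
        have h3 : ∀ S ∈ T.powerset, (if S.card = k ∧ T \ S ≠ ∅ then K ^ d * a (S ∪ T \ S) ^ 2
            else 0) ≤ K ^ d * (if k < T.card then a T ^ 2 else 0) := by
          intro S hS
          have hST := mem_powerset.1 hS
          rw [union_sdiff_of_subset hST]
          split_ifs with h4 h5 h5
          · exact le_rfl
          · exfalso
            refine h5 (h4.1 ▸ card_lt_card (hST.ssubset_of_ne fun h => h4.2 ?_))
            rw [h, sdiff_self]; rfl
          · positivity
          · simp
        refine (sum_le_card_nsmul _ _ _ h3).trans ?_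
        rw [card_powerset, nsmul_eq_mul, ← mul_assoc, mul_pow]
        push_cast
        have h6 := ha T hT
        gcongr
        norm_num
    _ ≤ _ := by
        rw [← mul_sum]
        gcongr
        exact sum_higher_levels_le ha hB h

lemma gaussn_bad_le {a : Finset (Fin n) → ℝ} {d k : ℕ} (ha : DegLE a d) {c : ℝ}
    (hc : |c| ≤ 1) {ρ : ℝ} (hρ : 0 ≤ ρ) (hW : 0 < levelWeight a k)
    (h : ∀ j ∈ Icc 1 d, k < j → levelWeight a j ≤ ρ * levelWeight a k) :
    (gaussn n).real {x | ∑ S ∈ univ.filter (fun S : Finset (Fin n) => S.card = k),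
        mlOn Sᶜ (fun J => a (S ∪ J) * c ^ J.card) x ^ 2 < levelWeight a k / 4}
      ≤ (4 * ((2 * hyperConst d) ^ d * d)) ^ d * ρ ^ d := by
  have hK := one_le_hyperConst d
  have hz := isStandard_gaussn (n := n)
  set W := levelWeight a k with hWdef
  set H : (Fin n → ℝ) → ℝ := fun x => ∑ S ∈ univ.filter (fun S : Finset (Fin n) => S.card = k),
    mlOn Sᶜ (tailCoeff a c S) x ^ 2 with hH
  have hHM : FiniteMoments H (gaussn n) :=
    FiniteMoments.sum _ fun S _ => (hz.finiteMoments_mlOn Sᶜ _).pow 2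
  have hmom : ∫ x, H x ^ d ∂gaussn n ≤ ((2 * hyperConst d) ^ d * (d * (ρ * W))) ^ d := by
    refine (integral_sum_pow_le (m := fun S => ∑ J ∈ Sᶜ.powerset,
      hyperConst d ^ J.card * tailCoeff a c S J ^ 2)
      (fun S => (hz.finiteMoments_mlOn Sᶜ (tailCoeff a c S)).pow 2) (fun S ω => sq_nonneg _)
      (fun S => sum_nonneg fun J _ => by positivity) d
      (fun S => by simpa only [← pow_mul] using hz.integral_mlOn_pow_le d Sᶜ (tailCoeff a c S))
      _).trans ?_
    exact pow_le_pow_left₀ (sum_nonneg fun S _ => sum_nonneg fun J _ => by positivity)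
      (sum_tailCoeff_le ha hc (by positivity) h) d
  have hsub : {x | ∑ S ∈ univ.filter (fun S : Finset (Fin n) => S.card = k),
        mlOn Sᶜ (fun J => a (S ∪ J) * c ^ J.card) x ^ 2 < W / 4}
      ⊆ {x | (W / 4) ^ d ≤ H x ^ d} := by
    intro x hx
    rw [Set.mem_ofPred_eq] at hx ⊢
    refine pow_le_pow_left₀ (by positivity) ?_ d
    have h1 : W ≤ ∑ S ∈ univ.filter (fun S : Finset (Fin n) => S.card = k),
        (2 * mlOn Sᶜ (fun J => a (S ∪ J) * c ^ J.card) x ^ 2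
          + 2 * mlOn Sᶜ (tailCoeff a c S) x ^ 2) := by
      rw [hWdef, levelWeight]
      refine sum_le_sum fun S _ => ?_
      rw [mlOn_eq_add_tail]
      nlinarith [sq_nonneg (a S + 2 * mlOn Sᶜ (tailCoeff a c S) x)]
    rw [sum_add_distrib, ← mul_sum, ← mul_sum] at h1
    simp only [hH]
    linarith
  have hmk := mul_meas_ge_le_integral_of_nonneg (μ := gaussn n) (f := fun x => H x ^ d)
    (Filter.Eventually.of_forall fun x => pow_nonneg (sum_nonneg fun S _ => sq_nonneg _) d)
    (hHM.integrable_pow d) ((W / 4) ^ d)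
  have h2 := measureReal_mono (μ := gaussn n) hsub
  have h3 : (W / 4) ^ d * (gaussn n).real {x | (W / 4) ^ d ≤ H x ^ d}
      ≤ (W / 4) ^ d * ((4 * ((2 * hyperConst d) ^ d * d)) ^ d * ρ ^ d) := by
    refine (hmk.trans hmom).trans (le_of_eq ?_)
    rw [← mul_pow, ← mul_pow]
    congr 1
    ring
  exact h2.trans (le_of_mul_le_mul_left h3 (by positivity))


lemma sum_levelWeight_eq {a : Finset (Fin n) → ℝ} {d : ℕ} (ha : DegLE a d) :
    ∑ k ∈ Icc 1 d, levelWeight a k = ∑ I ∈ univ.erase ∅, a I ^ 2 := by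
  have h1 : ∀ k ∈ Icc 1 d, levelWeight a k
      = ∑ I ∈ univ.erase (∅ : Finset (Fin n)), if I.card = k then a I ^ 2 else 0 := by
    intro k hk
    rw [levelWeight, sum_filter, ← add_sum_erase _ _ (mem_univ ∅), if_neg, zero_add]
    rw [card_empty]
    have := (mem_Icc.1 hk).1
    omega
  rw [sum_congr rfl h1, sum_comm]
  refine sum_congr rfl fun I hI => ?_
  have hI1 : 1 ≤ I.card := card_pos.2 (nonempty_iff_ne_empty.2 (ne_of_mem_erase hI))
  by_cases hz : a I = 0
  · simp [hz]
  rw [sum_eq_single_of_mem I.card (mem_Icc.2 ⟨hI1, ha I hz⟩)]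
  · simp
  · intro j _ hj; simp [Ne.symm hj]

lemma sin_pow_mul_sum_le (a : Finset (Fin n) → ℝ) (c s : ℝ) (x : Fin n → ℝ) (k : ℕ) :
    s ^ (2 * k) * ∑ S ∈ univ.filter (fun S : Finset (Fin n) => S.card = k),
      mlOn Sᶜ (fun J => a (S ∪ J) * c ^ J.card) x ^ 2 ≤ ∑ S, mixCoeff a c s x S ^ 2 := by
  rw [mul_sum]
  refine le_trans (sum_le_sum fun S hS => ?_) (sum_le_sum_of_subset_of_nonneg
    (filter_subset _ _) fun S _ _ => sq_nonneg _)
  rw [mixCoeff, mul_pow, ← pow_mul, (mem_filter.1 hS).2, mul_comm k 2]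

/-- A normalised polynomial of degree at most `d` in Gaussian variables is rarely tiny. -/
theorem gaussn_small_ball (d : ℕ) : ∃ c > 0, ∃ C, 0 ≤ C ∧ ∀ t : ℝ, 0 < t → t ≤ 1 →
    ∀ (n : ℕ) (a : Finset (Fin n) → ℝ), DegLE a d → ∑ I ∈ univ.erase ∅, a I ^ 2 = 1 →
    (gaussn n).real {x | |mlEval a x| ≤ c * t ^ (2 * d ^ 2 + d)} ≤ C * t ^ (2 * d) := by
  have hK2 := one_le_hyperConst 2
  have hKd := one_le_hyperConst d
  have hpi := Real.pi_pos
  refine ⟨1 / (8 ^ d * 4 * (d + 1)), by positivity,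
    4 * hyperConst 2 ^ (2 * d) * (2 * d * Real.pi) + (4 * ((2 * hyperConst d) ^ d * d)) ^ d,
    by positivity, fun t ht ht1 n a ha hsum => ?_⟩
  set c : ℝ := 1 / (8 ^ d * 4 * (d + 1)) with hc
  obtain ⟨k, hk, hWk, htail⟩ := exists_dominant_level (W := levelWeight a) (d := d)
    (ρ := t ^ 2) (by positivity) (pow_le_one₀ ht.le ht1) (by rw [sum_levelWeight_eq ha, hsum])
  obtain ⟨hk1, hkd⟩ := mem_Icc.1 hk
  have hd : (0 : ℝ) < d := by exact_mod_cast (by omega : 0 < d)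
  set W := levelWeight a k with hWdef
  have hW : t ^ (2 * d) / d ≤ W := by
    refine le_trans ?_ hWk
    rw [← pow_mul]
    gcongr ?_ / _
    exact pow_le_pow_of_le_one ht.le ht1 (by omega)
  have hW0 : 0 < W := lt_of_lt_of_le (by positivity) hW
  set τ := t ^ (2 * d) with hτ
  have hτ0 : 0 < τ := by positivity
  have hτ1 : τ ≤ 1 := pow_le_one₀ ht.le ht1
  have hsin : τ / 2 ≤ Real.sin τ := by
    have h1 := Real.mul_le_sin hτ0.le (by linarith [Real.pi_gt_three])
    have h2 : (1 : ℝ) / 2 ≤ 2 / Real.pi := by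
      rw [div_le_div_iff₀ (by norm_num) hpi]; linarith [Real.pi_le_four]
    nlinarith
  set good : Set (Fin n → ℝ) := {x | ∑ S ∈ univ.filter (fun S : Finset (Fin n) => S.card = k),
    mlOn Sᶜ (fun J => a (S ∪ J) * Real.cos τ ^ J.card) x ^ 2 < W / 4}ᶜ with hgood
  set E : Set (Fin n → ℝ) := {x | |mlEval a x| ≤ c * t ^ (2 * d ^ 2 + d)} with hE
  have hml := continuous_mlEval a
  have hEm : MeasurableSet E := measurableSet_le (by fun_prop) measurable_const
  have hgm : MeasurableSet good :=
    (measurableSet_lt (Finset.measurable_fun_sum _ fun S _ => (measurable_mlOn _ _).pow_const 2)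
      measurable_const).compl
  have hV : ∀ x ∈ good, (2 ^ (2 * d) * (c * t ^ (2 * d ^ 2 + d))) ^ 2
      < (∑ S, mixCoeff a (Real.cos τ) (Real.sin τ) x S ^ 2) / 2 := by
    intro x hx
    have hx' : W / 4 ≤ ∑ S ∈ univ.filter (fun S : Finset (Fin n) => S.card = k),
      mlOn Sᶜ (fun J => a (S ∪ J) * Real.cos τ ^ J.card) x ^ 2 := not_lt.1 hx
    have h1 := sin_pow_mul_sum_le a (Real.cos τ) (Real.sin τ) x k
    have h2 : (τ / 2) ^ (2 * d) ≤ Real.sin τ ^ (2 * k) :=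
      (pow_le_pow_of_le_one (by positivity) (by linarith) (by omega)).trans
        (pow_le_pow_left₀ (by positivity) hsin _)
    have h3 : (τ / 2) ^ (2 * d) * (τ / d / 4)
        ≤ ∑ S, mixCoeff a (Real.cos τ) (Real.sin τ) x S ^ 2 := by
      refine le_trans (mul_le_mul h2 (le_trans ?_ hx') (by positivity) ?_) h1
      · linarith
      · exact (by positivity : (0 : ℝ) ≤ (τ / 2) ^ (2 * d)).trans h2
    refine lt_of_lt_of_le ?_ (div_le_div_of_nonneg_right h3 (by norm_num))
    have h4 : (t ^ (2 * d ^ 2 + d)) ^ 2 = τ ^ (2 * d) * τ := by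
      rw [hτ, ← pow_mul, ← pow_mul, ← pow_add]; ring
    have h5 : (2 ^ (2 * d) * (c * t ^ (2 * d ^ 2 + d))) ^ 2
        = τ ^ (2 * d) * τ * (1 / 4 ^ d * (1 / (16 * (d + 1) ^ 2))) := by
      rw [mul_pow, mul_pow, h4, hc]
      have h6 : ((2 : ℝ) ^ (2 * d)) ^ 2 = 16 ^ d := by
        rw [← pow_mul, mul_assoc, mul_comm d 2, ← mul_assoc, pow_mul]; norm_num
      have h7 : ((8 : ℝ) ^ d) ^ 2 = 16 ^ d * 4 ^ d := by
        rw [← pow_mul, mul_comm d 2, pow_mul, ← mul_pow]; norm_num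
      rw [h6, div_pow, mul_pow, mul_pow, h7]
      field_simp
      norm_num
    have h8 : (τ / 2) ^ (2 * d) * (τ / d / 4) / 2
        = τ ^ (2 * d) * τ * (1 / 4 ^ d * (1 / (8 * d))) := by
      rw [div_pow, pow_mul 2 2 d]
      norm_num
      field_simp
      norm_num
    rw [h5, h8]
    have h9 : (1 : ℝ) / (16 * (d + 1) ^ 2) < 1 / (8 * d) :=
      one_div_lt_one_div_of_lt (by positivity) (by nlinarith)
    gcongr
  have hsplit : E ⊆ (E ∩ good) ∪ goodᶜ := fun x hx => by
    by_cases h : x ∈ good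
    · exact Or.inl ⟨hx, h⟩
    · exact Or.inr h
  have hcos : |Real.cos τ| ≤ 1 := Real.abs_cos_le_one τ
  have hA := gaussn_small_inter_good_le ha hτ0.le (hEm.inter hgm) (fun x hx => hx.1)
    fun x hx => hV x hx.2
  have hB := gaussn_bad_le ha hcos (by positivity) hW0 htail
  have hρ : (t ^ 2) ^ d = τ := by rw [← pow_mul]
  rw [hρ, ← hWdef, ← compl_compl {x | _ < W / 4}, ← hgood] at hB
  calc (gaussn n).real E ≤ (gaussn n).real ((E ∩ good) ∪ goodᶜ) := measureReal_mono hsplit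
    _ ≤ (gaussn n).real (E ∩ good) + (gaussn n).real goodᶜ := measureReal_union_le _ _
    _ ≤ _ := add_le_add hA hB
    _ = _ := by ring

end Levels

section Lindeberg

/-- A bounded function `Ψ 0` with bounded Taylor data `Ψ 1, Ψ 2, Ψ 3` and a uniform fourth-order
Taylor remainder. -/
structure TaylorData (Ψ : ℕ → ℝ → ℝ) (B : ℝ) : Prop where
  measurable : ∀ k, Measurable (Ψ k)
  bounded : ∀ k u, |Ψ k u| ≤ B
  remainder : ∀ u h, |Ψ 0 (u + h) - (Ψ 0 u + Ψ 1 u * h + Ψ 2 u * h ^ 2 / 2 + Ψ 3 u * h ^ 3 / 6)|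
    ≤ B * h ^ 4

lemma hasCompactSupport_iteratedDeriv {f : ℝ → ℝ} (hf : HasCompactSupport f) (k : ℕ) :
    HasCompactSupport (iteratedDeriv k f) := by
  induction k with
  | zero => simpa using hf
  | succ k ih => rw [iteratedDeriv_succ]; exact ih.deriv

lemma taylor_three {f : ℝ → ℝ} (hf : ContDiff ℝ 4 f) {B : ℝ}
    (hB : ∀ u, |iteratedDeriv 4 f u| ≤ B) (u h : ℝ) :
    |f (u + h) - (f u + iteratedDeriv 1 f u * h + iteratedDeriv 2 f u * h ^ 2 / 2
      + iteratedDeriv 3 f u * h ^ 3 / 6)| ≤ B * h ^ 4 := by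
  rcases eq_or_ne h 0 with rfl | hh
  · simp
  have hne : u ≠ u + h := by simpa using hh
  obtain ⟨v, -, hv⟩ := taylor_mean_remainder_lagrange_iteratedDeriv (n := 3) hne
    (f := f) (by exact_mod_cast hf.contDiffOn)
  have hw : ∀ k : ℕ, k ≤ 4 → iteratedDerivWithin k f (Set.uIcc u (u + h)) u = iteratedDeriv k f u :=
    fun k hk => iteratedDerivWithin_eq_iteratedDeriv (uniqueDiffOn_uIcc hne)
      (hf.contDiffAt.of_le (by exact_mod_cast hk)) Set.left_mem_uIcc
  rw [taylorWithinEval_succ, taylorWithinEval_succ, taylorWithinEval_succ, taylor_within_zero_eval,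
    hw _ (by norm_num), hw _ (by norm_num), hw _ (by norm_num)] at hv
  have h4 : (0 : ℝ) ≤ h ^ 4 := by positivity
  have heq : f (u + h) - (f u + iteratedDeriv 1 f u * h + iteratedDeriv 2 f u * h ^ 2 / 2
      + iteratedDeriv 3 f u * h ^ 3 / 6) = iteratedDeriv 4 f v * h ^ 4 / 24 := by
    norm_num [Nat.factorial] at hv
    rw [← hv, iteratedDeriv_one]
    ring
  rw [heq, abs_div, abs_mul, abs_of_nonneg h4, abs_of_nonneg (by norm_num : (0 : ℝ) ≤ 24)]
  have := mul_le_mul_of_nonneg_right (hB v) h4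
  have := mul_nonneg (abs_nonneg (iteratedDeriv 4 f v)) h4
  linarith

lemma exists_taylorData : ∃ (Ψ : ℕ → ℝ → ℝ) (B : ℝ), TaylorData Ψ B ∧ (∀ u, 0 ≤ Ψ 0 u) ∧
    (∀ u, Ψ 0 u ≤ 1) ∧ (∀ u, |u| ≤ 1 → Ψ 0 u = 1) ∧ (∀ u, 2 ≤ |u| → Ψ 0 u = 0) := by
  let β : ContDiffBump (0 : ℝ) := ⟨1, 2, by norm_num, by norm_num⟩
  have hcd : ContDiff ℝ 4 β := β.contDiff
  have hcont : ∀ k ≤ 4, Continuous (iteratedDeriv k β) := fun k hk =>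
    hcd.continuous_iteratedDeriv k (by exact_mod_cast hk)
  have hex : ∀ k : ℕ, ∃ C, k ≤ 4 → ∀ u, |iteratedDeriv k β u| ≤ C := by
    intro k
    by_cases hk : k ≤ 4
    · obtain ⟨C, hC⟩ := (hasCompactSupport_iteratedDeriv β.hasCompactSupport
        k).exists_bound_of_continuous (hcont k hk)
      exact ⟨C, fun _ => hC⟩
    · exact ⟨0, fun h => absurd h hk⟩
  choose C hC using hex
  set B := ∑ k ∈ range 5, |C k| with hB
  have hCB : ∀ k ≤ 4, ∀ u, |iteratedDeriv k β u| ≤ B := fun k hk u =>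
    ((hC k hk u).trans (le_abs_self _)).trans
      (single_le_sum (f := fun k => |C k|) (fun _ _ => abs_nonneg _) (mem_range.2 (by omega)))
  refine ⟨fun k => if k ≤ 4 then iteratedDeriv k β else 0, B, ⟨fun k => ?_, fun k u => ?_,
    fun u h => ?_⟩, fun u => ?_, fun u => ?_, fun u hu => ?_, fun u hu => ?_⟩
  · split_ifs with hk
    · exact (hcont k hk).measurable
    · exact measurable_const
  · split_ifs with hk
    · exact hCB k hk u
    · simpa using sum_nonneg fun k _ => abs_nonneg (C k)
  · simpa using taylor_three hcd (hCB 4 le_rfl) u h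
  · simpa using β.nonneg
  · simpa using β.le_one
  · simpa using β.one_of_mem_closedBall (x := u) (by simpa [β] using hu)
  · simpa using β.zero_of_le_dist (x := u) (by simpa [β] using hu)

lemma FiniteMoments.of_bounded {Ω : Type*} [MeasurableSpace Ω] {μ : Measure Ω}
    [IsFiniteMeasure μ] {f : Ω → ℝ} (hf : Measurable f) {B : ℝ} (hB : ∀ ω, |f ω| ≤ B) :
    FiniteMoments f μ :=
  ⟨hf, fun p => Integrable.of_bound (hf.abs.pow_const p).aestronglyMeasurable (B ^ p)
    (Filter.Eventually.of_forall fun ω => by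
      rw [Real.norm_eq_abs, abs_pow, abs_abs]
      exact pow_le_pow_left₀ (abs_nonneg _) (hB ω) p)⟩

variable {n : ℕ} {Ω : Type*} [MeasurableSpace Ω] {μ : Measure Ω} [IsProbabilityMeasure μ]

lemma sum_powerset_erase_insert_sq (a : Finset (Fin n) → ℝ) (i : Fin n) :
    ∑ I ∈ (univ.erase i).powerset, a (insert i I) ^ 2 = wsq a i := by
  unfold wsq
  refine sum_nbij' (fun I => insert i I) (fun I => I.erase i) ?_ ?_ ?_ ?_ ?_
  · intro I _; simp
  · intro I _
    exact mem_powerset.2 (erase_subset_erase i (subset_univ I))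
  · intro I hI
    exact erase_insert fun h => notMem_erase i univ (mem_powerset.1 hI h)
  · intro I hI
    exact insert_erase (mem_filter.1 hI).2
  · intro I _; rfl

/-- Expanding one variable to third order, only its first three moments matter up to the square of
its weight. -/
lemma integral_taylor_mlEval_le {Ψ : ℕ → ℝ → ℝ} {B : ℝ} (hΨ : TaylorData Ψ B)
    {z : Fin n → Ω → ℝ} (hz : IsStandard z μ) {a : Finset (Fin n) → ℝ} {d : ℕ} (ha : DegLE a d)
    (i : Fin n) :
    |(∫ ω, Ψ 0 (mlEval a (fun j => z j ω)) ∂μ)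
      - ((∫ ω, Ψ 0 (mlOn (univ.erase i) a (fun j => z j ω)) ∂μ)
        + (∫ ω, Ψ 2 (mlOn (univ.erase i) a (fun j => z j ω))
          * mlOn (univ.erase i) (fun I => a (insert i I)) (fun j => z j ω) ^ 2 ∂μ) / 2)|
      ≤ B * (1 + gaussMoment 4) * (hyperConst 2 ^ d * wsq a i) ^ 2 := by
  have hB0 : 0 ≤ B := (abs_nonneg _).trans (hΨ.bounded 0 0)
  set a' : Finset (Fin n) → ℝ := fun I => a (insert i I) with ha'
  set R : Ω → ℝ := fun ω => mlOn (univ.erase i) a (fun j => z j ω) with hR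
  set b : Ω → ℝ := fun ω => mlOn (univ.erase i) a' (fun j => z j ω) with hb
  have hi : i ∉ univ.erase i := notMem_erase i univ
  have hRM : FiniteMoments R μ := hz.finiteMoments_mlOn _ _
  have hbM : FiniteMoments b μ := hz.finiteMoments_mlOn _ _
  have hzM := hz.finiteMoments i
  have hp : ∀ ω, mlEval a (fun j => z j ω) = R ω + b ω * z i ω := by
    intro ω
    have h1 : insert i (univ.erase i) = (univ : Finset (Fin n)) := insert_erase (mem_univ i)
    rw [← mlOn_univ, ← h1, mlOn_insert hi]
    simp only [hR, hb]
    ring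
  have hΨM : ∀ k, FiniteMoments (fun ω => Ψ k (R ω)) μ := fun k =>
    .of_bounded ((hΨ.measurable k).comp hRM.measurable) fun ω => hΨ.bounded k _
  have hterm : ∀ k m, FiniteMoments (fun ω => Ψ k (R ω) * b ω ^ m * z i ω ^ m) μ := fun k m =>
    ((hΨM k).mul (hbM.pow m)).mul (hzM.pow m)
  have hsplit : ∀ k m, ∫ ω, Ψ k (R ω) * b ω ^ m * z i ω ^ m ∂μ
      = (∫ ω, Ψ k (R ω) * b ω ^ m ∂μ) * ∫ ω, z i ω ^ m ∂μ := fun k m =>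
    hz.integral_mul_of_dependsOn hi
      (G := fun x => Ψ k (mlOn (univ.erase i) a x) * mlOn (univ.erase i) a' x ^ m)
      (((hΨ.measurable k).comp (measurable_mlOn _ _)).mul ((measurable_mlOn _ _).pow_const _))
      (fun x y h => by simp only [dependsOn_mlOn _ _ h]) (H := fun t => t ^ m)
      (measurable_id.pow_const m)
  have hb4 : ∫ ω, b ω ^ 4 * z i ω ^ 4 ∂μ
      ≤ (hyperConst 2 ^ d * wsq a i) ^ 2 * (1 + gaussMoment 4) := by
    have h1 := hz.integral_mul_of_dependsOn hi (G := fun x => mlOn (univ.erase i) a' x ^ 4)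
      ((measurable_mlOn _ _).pow_const _) (fun x y h => by simp only [dependsOn_mlOn _ _ h])
      (H := fun t => t ^ 4) (measurable_id.pow_const 4)
    rw [h1]
    have h2 : ∫ ω, mlOn (univ.erase i) a' (fun j => z j ω) ^ 4 ∂μ
        ≤ (hyperConst 2 ^ d * wsq a i) ^ 2 := by
      refine (hz.integral_mlOn_pow_le 2 (univ.erase i) a').trans ?_
      have hK := one_le_hyperConst 2
      rw [← sum_powerset_erase_insert_sq]
      refine pow_le_pow_left₀ (sum_nonneg fun I _ => by positivity) (sum_hyperConst_le ?_ 2 _) 2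
      intro I hI
      exact (card_le_card (subset_insert i I)).trans (ha _ hI)
    exact mul_le_mul h2 (hz.even_moment i 2)
      (integral_nonneg fun ω => by simp only [Pi.zero_apply]; positivity) (sq_nonneg _)
  have hmain : (∫ ω, Ψ 0 (R ω) ∂μ) + (∫ ω, Ψ 2 (R ω) * b ω ^ 2 ∂μ) / 2
      = ∫ ω, (Ψ 0 (R ω) + Ψ 1 (R ω) * (b ω * z i ω) + Ψ 2 (R ω) * (b ω * z i ω) ^ 2 / 2
        + Ψ 3 (R ω) * (b ω * z i ω) ^ 3 / 6) ∂μ := by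
    have h1 : ∀ ω, Ψ 0 (R ω) + Ψ 1 (R ω) * (b ω * z i ω) + Ψ 2 (R ω) * (b ω * z i ω) ^ 2 / 2
        + Ψ 3 (R ω) * (b ω * z i ω) ^ 3 / 6
        = Ψ 0 (R ω) + Ψ 1 (R ω) * b ω ^ 1 * z i ω ^ 1
          + (1 / 2) * (Ψ 2 (R ω) * b ω ^ 2 * z i ω ^ 2)
          + (1 / 6) * (Ψ 3 (R ω) * b ω ^ 3 * z i ω ^ 3) := fun ω => by ring
    simp_rw [h1]
    rw [integral_add (((hΨM 0).add (hterm 1 1)).add ((hterm 2 2).const_mul _)).integrable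
        ((hterm 3 3).const_mul _).integrable,
      integral_add ((hΨM 0).add (hterm 1 1)).integrable ((hterm 2 2).const_mul _).integrable,
      integral_add (hΨM 0).integrable (hterm 1 1).integrable, integral_const_mul,
      integral_const_mul, hsplit, hsplit, hsplit, hz.odd_moment i 1 odd_one,
      hz.odd_moment i 3 (by decide), hz.second_moment i]
    ring
  have hpM : FiniteMoments (fun ω => Ψ 0 (mlEval a (fun j => z j ω))) μ := by
    refine .of_bounded ((hΨ.measurable 0).comp ?_) fun ω => hΨ.bounded 0 _
    simp_rw [hp]
    exact (hRM.add (hbM.mul hzM)).measurable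
  have hTM : Integrable (fun ω => Ψ 0 (R ω) + Ψ 1 (R ω) * (b ω * z i ω)
      + Ψ 2 (R ω) * (b ω * z i ω) ^ 2 / 2 + Ψ 3 (R ω) * (b ω * z i ω) ^ 3 / 6) μ := by
    have hbz := hbM.mul hzM
    exact ((((hΨM 0).integrable.add ((hΨM 1).mul hbz).integrable).add
      (((hΨM 2).mul (hbz.pow 2)).integrable.div_const 2)).add
      (((hΨM 3).mul (hbz.pow 3)).integrable.div_const 6))
  rw [hmain, ← integral_sub hpM.integrable hTM]
  calc _ ≤ ∫ ω, B * (b ω ^ 4 * z i ω ^ 4) ∂μ := by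
        rw [← Real.norm_eq_abs]
        refine norm_integral_le_of_norm_le
          (((hbM.pow 4).mul (hzM.pow 4)).const_mul B).integrable
          (Filter.Eventually.of_forall fun ω => ?_)
        rw [Real.norm_eq_abs, hp, ← mul_pow]
        exact hΨ.remainder _ _
    _ ≤ B * ((hyperConst 2 ^ d * wsq a i) ^ 2 * (1 + gaussMoment 4)) := by
        rw [integral_const_mul]
        exact mul_le_mul_of_nonneg_left hb4 hB0
    _ = _ := by ring

lemma abs_integral_sub_le_of_eq_off {Ψ : ℕ → ℝ → ℝ} {B : ℝ} (hΨ : TaylorData Ψ B)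
    {z z' : Fin n → Ω → ℝ} (hz : IsStandard z μ) (hz' : IsStandard z' μ)
    {a : Finset (Fin n) → ℝ} {d : ℕ} (ha : DegLE a d) (i : Fin n)
    (hzz : ∀ j ≠ i, z j = z' j) :
    |(∫ ω, Ψ 0 (mlEval a (fun j => z j ω)) ∂μ) - ∫ ω, Ψ 0 (mlEval a (fun j => z' j ω)) ∂μ|
      ≤ 2 * (B * (1 + gaussMoment 4) * (hyperConst 2 ^ d * wsq a i) ^ 2) := by
  have h1 := integral_taylor_mlEval_le hΨ hz ha i
  have h2 := integral_taylor_mlEval_le hΨ hz' ha i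
  have h3 : ∀ (c : Finset (Fin n) → ℝ) ω, mlOn (univ.erase i) c (fun j => z j ω)
      = mlOn (univ.erase i) c (fun j => z' j ω) := fun c ω =>
    dependsOn_mlOn _ _ fun j hj => by
      rw [hzz j (ne_of_mem_erase (mem_coe.1 hj))]
  simp only [h3] at h1
  rw [abs_le] at *
  constructor <;> linarith [h1.1, h1.2, h2.1, h2.2]

end Lindeberg

section Invariance

variable {n : ℕ}

/-- The uniform measure on `Bool`. -/
def fairCoin : Measure Bool := (PMF.uniformOfFintype Bool).toMeasure

instance : IsProbabilityMeasure fairCoin := by unfold fairCoin; infer_instance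

lemma fairCoin_real_singleton (b : Bool) : fairCoin.real {b} = 1 / 2 := by
  rw [measureReal_def, fairCoin, PMF.toMeasure_apply_singleton _ _ (measurableSet_singleton b)]
  simp

lemma pmOne_sq (b : Bool) : pmOne b ^ 2 = 1 := by
  cases b <;> simp [pmOne]

lemma abs_pmOne (b : Bool) : |pmOne b| = 1 := by
  cases b <;> simp [pmOne]

lemma integral_fairCoin (f : Bool → ℝ) : ∫ b, f b ∂fairCoin = (f true + f false) / 2 := by
  rw [integral_fintype (.of_finite)]
  simp only [fairCoin_real_singleton, Fintype.sum_bool, smul_eq_mul]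
  ring

lemma integral_pi_fairCoin (F : (Fin n → Bool) → ℝ) :
    ∫ x, F x ∂(Measure.pi fun _ => fairCoin) = (1 / 2 ^ n) * ∑ x, F x := by
  rw [integral_fintype (.of_finite), mul_sum]
  refine sum_congr rfl fun x _ => ?_
  rw [measureReal_def, Measure.pi_singleton, ENNReal.toReal_prod]
  simp only [← measureReal_def, fairCoin_real_singleton, prod_const, card_univ, Fintype.card_fin,
    smul_eq_mul, one_div, inv_pow]

/-- Variables that are Gaussian on `s` and Rademacher off `s`. -/
def hybrid (s : Finset (Fin n)) (i : Fin n) (p : Bool × ℝ) : ℝ := if i ∈ s then p.2 else pmOne p.1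

lemma integral_hybrid_pow (s : Finset (Fin n)) (i : Fin n) (k : ℕ) :
    ∫ p, hybrid s i p ^ k ∂(fairCoin.prod (gaussianReal 0 1))
      = if i ∈ s then gaussMoment k else (1 + (-1) ^ k) / 2 := by
  unfold hybrid
  split_ifs
  · have := integral_fun_snd (μ := fairCoin) (ν := gaussianReal 0 1) fun x : ℝ => x ^ k
    rw [this, probReal_univ, one_smul, gaussMoment]
  · have := integral_fun_fst (μ := fairCoin) (ν := gaussianReal 0 1) fun b => pmOne b ^ k
    rw [this, integral_fairCoin]
    simp [pmOne]

lemma isStandard_hybrid (s : Finset (Fin n)) :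
    IsStandard (fun i (ω : Fin n → Bool × ℝ) => hybrid s i (ω i))
      (Measure.pi fun _ => fairCoin.prod (gaussianReal 0 1)) := by
  refine isStandard_pi (fun i => ?_) (fun i k hk => ?_) (fun i => ?_) fun i k => ?_
  · unfold hybrid
    split_ifs
    · exact ⟨measurable_snd, fun p => measurePreserving_snd.integrable_comp_of_integrable
        (finiteMoments_gaussianReal.integrable_abs_pow p)⟩
    · exact .of_bounded ((Measurable.of_discrete (f := pmOne)).comp measurable_fst) (B := 1)
        fun p => (abs_pmOne p.1).le
  · rw [integral_hybrid_pow]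
    split_ifs
    · exact gaussMoment_odd hk
    · rw [hk.neg_one_pow]; norm_num
  · rw [integral_hybrid_pow]
    split_ifs
    · exact gaussMoment_two
    · norm_num
  · rw [integral_hybrid_pow]
    split_ifs
    · linarith
    · have := gaussMoment_even_nonneg k
      rw [pow_mul]
      norm_num
      exact this

/-- A form of the invariance principle for low-degree multilinear polynomials. -/
lemma abs_cube_average_sub_gaussn_le {Ψ : ℕ → ℝ → ℝ} {B : ℝ} (hΨ : TaylorData Ψ B)
    {a : Finset (Fin n) → ℝ} {d : ℕ} (ha : DegLE a d) :
    |(1 / 2 ^ n) * (∑ x : Fin n → Bool, Ψ 0 (mlEval a (fun i => pmOne (x i))))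
      - ∫ x, Ψ 0 (mlEval a x) ∂gaussn n|
      ≤ 2 * B * (1 + gaussMoment 4) * (hyperConst 2 ^ d) ^ 2 * ∑ i, wsq a i ^ 2 := by
  set ν := fairCoin.prod (gaussianReal 0 1) with hν
  set A : Finset (Fin n) → ℝ := fun s =>
    ∫ ω : Fin n → Bool × ℝ, Ψ 0 (mlEval a (fun i => hybrid s i (ω i))) ∂(Measure.pi fun _ => ν)
    with hA
  have hchain : ∀ s : Finset (Fin n), |A ∅ - A s|
      ≤ ∑ i ∈ s, 2 * (B * (1 + gaussMoment 4) * (hyperConst 2 ^ d * wsq a i) ^ 2) := by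
    intro s
    induction s using Finset.induction_on with
    | empty => simp
    | insert i s hi ih =>
      have hstep := abs_integral_sub_le_of_eq_off hΨ (isStandard_hybrid s)
        (isStandard_hybrid (insert i s)) ha i fun j hj => by
          funext ω
          simp [hybrid, hj]
      rw [sum_insert hi, add_comm]
      exact (abs_sub_le _ (A s) _).trans (add_le_add ih hstep)
  have h0 : A ∅ = (1 / 2 ^ n) * ∑ x : Fin n → Bool, Ψ 0 (mlEval a (fun i => pmOne (x i))) := by
    rw [← integral_pi_fairCoin (fun x : Fin n → Bool => Ψ 0 (mlEval a (fun i => pmOne (x i))))]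
    have hmp := measurePreserving_pi (fun _ : Fin n => ν) (fun _ => fairCoin)
      (f := fun _ => Prod.fst) fun _ => measurePreserving_fst
    rw [← hmp.map_eq, integral_map hmp.measurable.aemeasurable
      (Measurable.of_discrete).aestronglyMeasurable]
    simp [hA, hybrid]
  have h1 : A univ = ∫ x, Ψ 0 (mlEval a x) ∂gaussn n := by
    have hmp := measurePreserving_pi (fun _ : Fin n => ν) (fun _ => gaussianReal 0 1)
      (f := fun _ => Prod.snd) fun _ => measurePreserving_snd
    rw [gaussn, ← hmp.map_eq, integral_map hmp.measurable.aemeasurable (f := fun x => Ψ 0 (mlEval a x))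
      ((hΨ.measurable 0).comp (continuous_mlEval a).measurable).aestronglyMeasurable]
    simp [hA, hybrid]
  rw [← h0, ← h1]
  refine (hchain univ).trans (le_of_eq ?_)
  rw [mul_sum]
  exact sum_congr rfl fun i _ => by ring

end Invariance

section Noise

variable {n : ℕ}

lemma isStandard_pmOne :
    IsStandard (fun i (x : Fin n → Bool) => pmOne (x i)) (Measure.pi fun _ => fairCoin) := by
  refine isStandard_pi (h := fun _ => pmOne) (fun i => .of_bounded .of_discrete (B := 1)
    fun b => (abs_pmOne b).le) (fun i k hk => ?_) (fun i => ?_) fun i k => ?_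
  · rw [integral_fairCoin]; simp [pmOne, hk.neg_one_pow]
  · rw [integral_fairCoin]; simp [pmOne_sq]
  · rw [integral_fairCoin]
    have := gaussMoment_even_nonneg k
    simpa [pow_mul, pmOne_sq] using this

lemma cube_average_mlEval_sq (b : Finset (Fin n) → ℝ) :
    (1 / 2 ^ n) * ∑ x : Fin n → Bool, mlEval b (fun i => pmOne (x i)) ^ 2 = ∑ I, b I ^ 2 := by
  rw [← integral_pi_fairCoin (fun x : Fin n → Bool => mlEval b (fun i => pmOne (x i)) ^ 2)]
  simpa [← mlOn_univ] using isStandard_pmOne.integral_mlOn_sq univ b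

/-- The weight of the flip pattern `s` at noise rate `ε`. -/
def flipWeight (ε : ℝ) (s : Fin n → Bool) : ℝ := ∏ i, if s i then ε else 1 - ε

lemma flipWeight_nonneg {ε : ℝ} (h0 : 0 ≤ ε) (h1 : ε ≤ 1) (s : Fin n → Bool) :
    0 ≤ flipWeight ε s :=
  prod_nonneg fun i _ => by split_ifs <;> linarith

lemma sum_flipWeight_mul_prod (ε : ℝ) (I : Finset (Fin n)) :
    ∑ s : Fin n → Bool, flipWeight ε s * ∏ i ∈ I, (if s i then (-1 : ℝ) else 1)
      = (1 - 2 * ε) ^ I.card := by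
  have h := prod_univ_sum (fun _ : Fin n => (univ : Finset Bool)) fun i b =>
    (if b then ε else 1 - ε) * if i ∈ I then (if b then (-1 : ℝ) else 1) else 1
  rw [Fintype.piFinset_univ] at h
  have h1 : ∀ s : Fin n → Bool, flipWeight ε s * ∏ i ∈ I, (if s i then (-1 : ℝ) else 1)
      = ∏ i, (if s i then ε else 1 - ε) * if i ∈ I then (if s i then (-1 : ℝ) else 1) else 1 := by
    intro s
    rw [prod_mul_distrib, flipWeight, prod_ite_mem, univ_inter]
  rw [sum_congr rfl fun s _ => h1 s, ← h, ← prod_const, ← univ_inter I, ← prod_ite_mem]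
  refine prod_congr rfl fun i _ => ?_
  by_cases hi : i ∈ I
  · simp [hi]; ring
  · simp [hi]

lemma sum_flipWeight (ε : ℝ) : ∑ s : Fin n → Bool, flipWeight ε s = 1 := by
  simpa using sum_flipWeight_mul_prod (n := n) ε ∅

/-- Chebyshev-type bound on the squared change of a low-degree polynomial under noise. -/
lemma noise_sq_le {b : Finset (Fin n) → ℝ} {d : ℕ} (hb : DegLE b d) {ε : ℝ} (h0 : 0 ≤ ε)
    (h1 : ε ≤ 1) :
    (1 / 2 ^ n) * ∑ x : Fin n → Bool, ∑ s : Fin n → Bool, flipWeight ε s *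
      (mlEval b (fun i => pmOne (x i)) - mlEval b (fun i => pmOne (xor (s i) (x i)))) ^ 2
      ≤ 4 * d * ε * ∑ I ∈ univ.erase ∅, b I ^ 2 := by
  have hdiff : ∀ x s : Fin n → Bool,
      mlEval b (fun i => pmOne (x i)) - mlEval b (fun i => pmOne (xor (s i) (x i)))
        = mlEval (fun I => b I * (1 - ∏ i ∈ I, if s i then (-1 : ℝ) else 1))
            (fun i => pmOne (x i)) := by
    intro x s
    have hx : ∀ i, pmOne (xor (s i) (x i)) = (if s i then (-1 : ℝ) else 1) * pmOne (x i) := by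
      intro i
      cases s i <;> cases x i <;> simp [pmOne]
    simp only [mlEval, hx, prod_mul_distrib, ← sum_sub_distrib]
    exact sum_congr rfl fun I _ => by ring
  have hsq : ∀ (s : Fin n → Bool) (I : Finset (Fin n)),
      (b I * (1 - ∏ i ∈ I, if s i then (-1 : ℝ) else 1)) ^ 2
        = b I ^ 2 * (2 - 2 * ∏ i ∈ I, if s i then (-1 : ℝ) else 1) := by
    intro s I
    have : (∏ i ∈ I, if s i then (-1 : ℝ) else 1) ^ 2 = 1 := by
      rw [← prod_pow]
      exact prod_eq_one fun i _ => by split_ifs <;> norm_num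
    linear_combination b I ^ 2 * this
  have hexp : ∀ I, ∑ s : Fin n → Bool, flipWeight ε s *
      (b I ^ 2 * (2 - 2 * ∏ i ∈ I, if s i then (-1 : ℝ) else 1))
        = b I ^ 2 * (2 - 2 * (1 - 2 * ε) ^ I.card) := by
    intro I
    rw [← sum_flipWeight_mul_prod, mul_sub, mul_left_comm, mul_sum, mul_sum]
    have h2 : b I ^ 2 * 2 = ∑ s : Fin n → Bool, flipWeight ε s * (b I ^ 2 * 2) := by
      rw [← sum_mul, sum_flipWeight, one_mul]
    rw [h2, ← sum_sub_distrib]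
    exact sum_congr rfl fun s _ => by ring
  rw [sum_comm, mul_sum]
  have h3 : ∀ s : Fin n → Bool, 1 / 2 ^ n * ∑ x : Fin n → Bool, flipWeight ε s *
      (mlEval b (fun i => pmOne (x i)) - mlEval b (fun i => pmOne (xor (s i) (x i)))) ^ 2
      = ∑ I, flipWeight ε s * (b I ^ 2 * (2 - 2 * ∏ i ∈ I, if s i then (-1 : ℝ) else 1)) := by
    intro s
    simp_rw [hdiff]
    rw [← mul_sum, mul_left_comm, cube_average_mlEval_sq, mul_sum]
    simp_rw [hsq]
  rw [sum_congr rfl fun s _ => h3 s, sum_comm, sum_congr rfl fun I _ => hexp I,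
    ← add_sum_erase _ _ (mem_univ ∅), mul_sum]
  simp only [card_empty, pow_zero, mul_one, sub_self, mul_zero, zero_add]
  refine sum_le_sum fun I _ => ?_
  by_cases hI : b I = 0
  · simp [hI]
  have h4 := one_add_mul_le_pow (a := -(2 * ε)) (by linarith) I.card
  have h5 : (I.card : ℝ) ≤ d := by exact_mod_cast hb I hI
  have h6 : 2 - 2 * (1 - 2 * ε) ^ I.card ≤ 4 * d * ε := by
    rw [← sub_eq_add_neg] at h4
    nlinarith
  rw [mul_comm]
  exact mul_le_mul_of_nonneg_right h6 (sq_nonneg _)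

lemma noiseSens_le {b : Finset (Fin n) → ℝ} {d : ℕ} (hb : DegLE b d) {ε δ : ℝ} (h0 : 0 ≤ ε)
    (h1 : ε ≤ 1) (hδ : 0 < δ) {f : (Fin n → Bool) → Bool}
    (hf : ∀ x, (f x = true ↔ 0 ≤ mlEval b (fun i => pmOne (x i)))) :
    noiseSens ε f ≤
      (1 / 2 ^ n) * (∑ x : Fin n → Bool, if |mlEval b (fun i => pmOne (x i))| ≤ δ then 1 else 0)
        + 4 * d * ε * (∑ I ∈ univ.erase ∅, b I ^ 2) / δ ^ 2 := by
  set p : (Fin n → Bool) → ℝ := fun x => mlEval b (fun i => pmOne (x i)) with hp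
  have hpt : ∀ x y : Fin n → Bool, (if f x ≠ f y then (1 : ℝ) else 0)
      ≤ (if |p x| ≤ δ then 1 else 0) + (p x - p y) ^ 2 / δ ^ 2 := by
    intro x y
    by_cases hxy : f x = f y
    · rw [if_neg (not_not.2 hxy)]
      have : (0 : ℝ) ≤ if |p x| ≤ δ then 1 else 0 := by split_ifs <;> norm_num
      positivity
    by_cases hx : |p x| ≤ δ
    · rw [if_pos hxy, if_pos hx]
      have : 0 ≤ (p x - p y) ^ 2 / δ ^ 2 := by positivity
      linarith
    rw [if_pos hxy, if_neg hx, zero_add, one_le_div (by positivity)]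
    rw [not_le] at hx
    have hfx := hf x
    have hfy := hf y
    have h2 : |p x| ≤ |p x - p y| := by
      rcases le_or_gt 0 (p x) with h | h
      · have hy : p y < 0 := by
          by_contra! h'
          exact hxy ((hfx.2 h).trans (hfy.2 h').symm)
        rw [abs_of_nonneg h, abs_of_nonneg (by linarith)]; linarith
      · have hy : 0 ≤ p y := by
          by_contra! h'
          refine hxy ?_
          rw [Bool.eq_false_iff.2 fun h2 => absurd (hfx.1 h2) (not_le.2 h),
            Bool.eq_false_iff.2 fun h2 => absurd (hfy.1 h2) (not_le.2 h')]
        rw [abs_of_neg h, abs_of_neg (by linarith)]; linarith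
    rw [← sq_abs (p x - p y)]
    exact pow_le_pow_left₀ hδ.le (hx.le.trans h2) 2
  have hN := noise_sq_le hb h0 h1
  calc noiseSens ε f ≤ (1 / 2 ^ n) * ∑ x : Fin n → Bool, ∑ s : Fin n → Bool, flipWeight ε s *
        ((if |p x| ≤ δ then 1 else 0) + (p x - p (fun i => xor (s i) (x i))) ^ 2 / δ ^ 2) := by
        exact mul_le_mul_of_nonneg_left (sum_le_sum fun x _ => sum_le_sum fun s _ =>
          mul_le_mul_of_nonneg_left (hpt x _) (flipWeight_nonneg h0 h1 s)) (by positivity)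
    _ = (1 / 2 ^ n) * (∑ x : Fin n → Bool, if |p x| ≤ δ then 1 else 0)
        + ((1 / 2 ^ n) * ∑ x : Fin n → Bool, ∑ s : Fin n → Bool, flipWeight ε s *
          (p x - p (fun i => xor (s i) (x i))) ^ 2) / δ ^ 2 := by
        simp only [mul_add, sum_add_distrib, ← sum_mul, sum_flipWeight, one_mul, mul_div_assoc',
          ← sum_div]
    _ ≤ _ := by gcongr

end Noise

section Assembly

lemma sum_wsq_le {n : ℕ} {b : Finset (Fin n) → ℝ} {d : ℕ} (hb : DegLE b d) :
    ∑ i, wsq b i ≤ d * ∑ I ∈ univ.erase ∅, b I ^ 2 := by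
  have h1 : ∑ i, wsq b i = ∑ I : Finset (Fin n), I.card * b I ^ 2 := by
    simp only [wsq, sum_filter]
    rw [sum_comm]
    refine sum_congr rfl fun I _ => ?_
    rw [← sum_filter, filter_mem_eq_inter, univ_inter, sum_const, nsmul_eq_mul]
  rw [h1, ← add_sum_erase _ _ (mem_univ ∅), mul_sum]
  simp only [card_empty, Nat.cast_zero, zero_mul, zero_add]
  refine sum_le_sum fun I _ => ?_
  by_cases hI : b I = 0
  · simp [hI]
  · gcongr
    exact hb I hI

lemma mlEval_const_mul {n : ℕ} (c : ℝ) (a : Finset (Fin n) → ℝ) (x : Fin n → ℝ) :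
    mlEval (fun I => c * a I) x = c * mlEval a x := by
  simp only [mlEval, mul_sum, mul_assoc]

lemma wsq_const_mul {n : ℕ} (c : ℝ) (a : Finset (Fin n) → ℝ) (i : Fin n) :
    wsq (fun I => c * a I) i = c ^ 2 * wsq a i := by
  simp only [wsq, mul_sum, mul_pow]

lemma DegLE.const_mul {n : ℕ} {a : Finset (Fin n) → ℝ} {d : ℕ} (ha : DegLE a d) (c : ℝ) :
    DegLE (fun I => c * a I) d :=
  fun I hI => ha I (right_ne_zero_of_mul hI)

/-- Small-ball bound for normalised low-degree polynomials on the cube. -/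
lemma cube_small_ball (d : ℕ) : ∃ c > 0, ∃ C, 0 ≤ C ∧ ∀ t : ℝ, 0 < t → t ≤ 1 →
    ∀ (n : ℕ) (a : Finset (Fin n) → ℝ), DegLE a d → ∑ I ∈ univ.erase ∅, a I ^ 2 = 1 →
    (1 / 2 ^ n) * (∑ x : Fin n → Bool,
      if |mlEval a (fun i => pmOne (x i))| ≤ c * t ^ (2 * d ^ 2 + d) then (1 : ℝ) else 0)
      ≤ C * (t ^ (2 * d) + (∑ i, wsq a i ^ 2) / (t ^ (2 * d ^ 2 + d)) ^ 4) := by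
  obtain ⟨c, hc, C, hC, hball⟩ := gaussn_small_ball d
  obtain ⟨Ψ, B, hΨ, hΨ0, hΨ1, hΨin, hΨout⟩ := exists_taylorData
  have hB : 0 ≤ B := (abs_nonneg _).trans (hΨ.bounded 0 0)
  have hM : 0 ≤ gaussMoment 4 := gaussMoment_even_nonneg 2
  have hK := one_le_hyperConst 2
  set L := 2 * B * (1 + gaussMoment 4) * (hyperConst 2 ^ d) ^ 2 with hL
  have hL0 : 0 ≤ L := by positivity
  refine ⟨c / 2, by positivity, C + L / (c / 2) ^ 4, by positivity,
    fun t ht ht1 n a ha hsum => ?_⟩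
  set m := 2 * d ^ 2 + d
  set δ := c / 2 * t ^ m with hδ
  have hδ0 : 0 < δ := by positivity
  have hinv := abs_cube_average_sub_gaussn_le hΨ (ha.const_mul δ⁻¹)
  simp only [mlEval_const_mul, wsq_const_mul] at hinv
  have h1 : (1 / 2 ^ n) * (∑ x : Fin n → Bool,
      if |mlEval a (fun i => pmOne (x i))| ≤ δ then (1 : ℝ) else 0)
      ≤ (1 / 2 ^ n) * ∑ x : Fin n → Bool, Ψ 0 (δ⁻¹ * mlEval a (fun i => pmOne (x i))) := by
    gcongr with x _
    split_ifs with h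
    · rw [hΨin]
      rw [abs_mul, abs_of_pos (inv_pos.2 hδ0), inv_mul_le_iff₀ hδ0, mul_one]
      exact h
    · exact hΨ0 _
  have hml := continuous_mlEval a
  have h2 : ∫ x, Ψ 0 (δ⁻¹ * mlEval a x) ∂gaussn n ≤ C * t ^ (2 * d) := by
    refine le_trans ?_ (hball t ht ht1 n a ha hsum)
    set E : Set (Fin n → ℝ) := {x | |mlEval a x| ≤ c * t ^ m}
    have hE : MeasurableSet E := measurableSet_le (by fun_prop) measurable_const
    rw [← integral_indicator_one hE]
    refine integral_mono_of_nonneg (Filter.Eventually.of_forall fun x => hΨ0 _)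
      ((integrable_const (1 : ℝ)).indicator hE) (Filter.Eventually.of_forall fun x => ?_)
    by_cases hx : x ∈ E
    · rw [Set.indicator_of_mem hx]; exact hΨ1 _
    · rw [Set.indicator_of_notMem hx]
      refine (hΨout _ ?_).le
      rw [abs_mul, abs_of_pos (inv_pos.2 hδ0), le_inv_mul_iff₀ hδ0]
      have : c * t ^ m < |mlEval a x| := not_le.1 hx
      rw [hδ]
      linarith
  have h3 : ∑ i, (δ⁻¹ ^ 2 * wsq a i) ^ 2
      = (∑ i, wsq a i ^ 2) / (t ^ m) ^ 4 * (1 / (c / 2) ^ 4) := by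
    simp only [mul_pow, ← mul_sum]
    rw [hδ]
    field_simp
  rw [h3] at hinv
  have h4 := (abs_le.1 hinv).2
  have h5 : 0 ≤ (∑ i, wsq a i ^ 2) / (t ^ m) ^ 4 := by positivity
  have h6 : 0 ≤ t ^ (2 * d) := by positivity
  have h7 : 0 ≤ L / (c / 2) ^ 4 := by positivity
  have h8 : L * ((∑ i, wsq a i ^ 2) / (t ^ m) ^ 4 * (1 / (c / 2) ^ 4))
      = L / (c / 2) ^ 4 * ((∑ i, wsq a i ^ 2) / (t ^ m) ^ 4) := by ring
  rw [h8] at h4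
  nlinarith [mul_nonneg hC h5, mul_nonneg h7 h6]

lemma exists_noiseSens_le_of_normalised (d : ℕ) (hd : 1 ≤ d) :
    ∃ Cd : ℝ, ∀ ε : ℝ, 0 < ε → ε < 1 →
    ∀ (n : ℕ) (b : Finset (Fin n) → ℝ), DegLE b d → ∑ I ∈ univ.erase ∅, b I ^ 2 = 1 →
    Regular b ε → ∀ f : (Fin n → Bool) → Bool,
    (∀ x, (f x = true ↔ 0 ≤ mlEval b (fun i => pmOne (x i)))) →
    noiseSens ε f ≤ Cd * ε ^ ((1 : ℝ) / (2 * (d : ℝ) + 2)) := by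
  obtain ⟨c, hc, C, hC, hball⟩ := cube_small_ball d
  refine ⟨C * (1 + d ^ 2) + 4 * d / c ^ 2, fun ε h0 h1 n b hb hsum hreg f hf => ?_⟩
  have hd' : (0 : ℝ) < d := by exact_mod_cast hd
  set t : ℝ := ε ^ ((1 : ℝ) / (2 * d * (2 * d + 2))) with ht
  have ht0 : 0 < t := Real.rpow_pos_of_pos h0 _
  have ht1 : t ≤ 1 := Real.rpow_le_one h0.le h1.le (by positivity)
  have hs : t ^ (2 * d) = ε ^ ((1 : ℝ) / (2 * (d : ℝ) + 2)) := by
    rw [ht, ← Real.rpow_mul_natCast h0.le]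
    congr 1
    push_cast
    field_simp
  have hε : t ^ (2 * d * (2 * d + 2)) = ε := by
    rw [ht, ← Real.rpow_mul_natCast h0.le]
    have : (1 : ℝ) / (2 * d * (2 * d + 2)) * ((2 * d * (2 * d + 2) : ℕ) : ℝ) = 1 := by
      push_cast
      field_simp
    rw [this, Real.rpow_one]
  rw [← hs]
  set m := 2 * d ^ 2 + d with hm
  have hεm : ε = t ^ (2 * d) * (t ^ m) ^ 2 := by
    rw [← hε, ← pow_mul, ← pow_add, hm]
    ring
  have hsmall := hball t ht0 ht1 n b hb hsum
  have hnoise := noiseSens_le hb h0.le h1.le (δ := c * t ^ m) (by positivity) hf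
  have hw := sum_wsq_le hb
  rw [hsum, mul_one] at hw hnoise
  have hw0 : 0 ≤ ∑ i, wsq b i := sum_nonneg fun i _ => sum_nonneg fun I _ => sq_nonneg _
  have hreg' : ∑ i, wsq b i ^ 2 ≤ ε ^ 2 * d ^ 2 :=
    hreg.trans (by gcongr)
  have hs1 : t ^ (2 * d) ≤ 1 := pow_le_one₀ ht0.le ht1
  have hs0 : 0 < t ^ (2 * d) := by positivity
  have h2 : (∑ i, wsq b i ^ 2) / (t ^ m) ^ 4 ≤ d ^ 2 * t ^ (2 * d) := by
    rw [div_le_iff₀ (by positivity)]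
    refine hreg'.trans ?_
    rw [hεm]
    have h4 : (t ^ (2 * d) * (t ^ m) ^ 2) ^ 2 * (d : ℝ) ^ 2
        = (d ^ 2 * t ^ (2 * d) * (t ^ m) ^ 4) * t ^ (2 * d) := by ring
    rw [h4]
    exact mul_le_of_le_one_right (by positivity) hs1
  have h3 : 4 * d * ε / (c * t ^ m) ^ 2 = 4 * d / c ^ 2 * t ^ (2 * d) := by
    rw [hεm]
    field_simp
  rw [h3] at hnoise
  have h5 := hsmall.trans (mul_le_mul_of_nonneg_left (add_le_add_right h2 (t ^ (2 * d))) hC)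
  linarith

end Assembly

/-- Theorem 6.3: for each `d ≥ 1` there is a constant `C_d` such that
every `ε`-regular degree-`d` PTF `f = sign(P - θ)` (with `P` nonzero, multilinear, zero
constant term) satisfies `NS_ε(f) ≤ C_d ε^{1/(2d+2)}`. -/
theorem noise_sensitivity_regular_PTF (d : ℕ) (hd : 1 ≤ d) :
    ∃ Cd : ℝ, ∀ (ε : ℝ), 0 < ε → ε < 1 →
      ∀ (n : ℕ) (a : Finset (Fin n) → ℝ) (θ : ℝ), DegLE a d → a ∅ = 0 →
        (∃ I, a I ≠ 0) → Regular a ε →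
          ∀ f : (Fin n → Bool) → Bool,
            (∀ x, (f x = true ↔ 0 ≤ mlEval a (fun i => pmOne (x i)) - θ)) →
              noiseSens ε f ≤ Cd * ε ^ ((1 : ℝ) / (2 * (d : ℝ) + 2)) := by
  obtain ⟨Cd, hC⟩ := exists_noiseSens_le_of_normalised d hd
  refine ⟨Cd, fun ε h0 h1 n a θ ha ha0 ⟨J, hJ⟩ hreg f hf => ?_⟩
  have hJ0 : J ≠ ∅ := fun h => hJ (h ▸ ha0)
  set W := ∑ I ∈ univ.erase ∅, a I ^ 2 with hW
  have hW0 : 0 < W := sum_pos' (fun _ _ => sq_nonneg _)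
    ⟨J, mem_erase.2 ⟨hJ0, mem_univ _⟩, by positivity⟩
  set r := (√W)⁻¹ with hr
  have hr0 : 0 < r := by positivity
  have hr2 : r ^ 2 * W = 1 := by
    rw [hr, inv_pow, Real.sq_sqrt hW0.le, inv_mul_cancel₀ hW0.ne']
  set a' := Function.update a ∅ (-θ) with ha'
  have hne : ∀ I, I ≠ ∅ → a' I = a I := fun I hI => Function.update_of_ne hI _ _
  have hdeg : DegLE a' d := fun I hI => by
    by_cases h : I = ∅
    · simp [h]
    · exact ha I (hne I h ▸ hI)
  have hwsq : ∀ i, wsq (fun I => r * a' I) i = r ^ 2 * wsq a i := fun i => by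
    rw [wsq_const_mul]
    congr 1
    exact sum_congr rfl fun I hI => by rw [hne I (ne_empty_of_mem (mem_filter.1 hI).2)]
  have heval : ∀ x, mlEval a' x = mlEval a x - θ := fun x => by
    simp only [mlEval]
    rw [← add_sum_erase _ _ (mem_univ ∅), ← add_sum_erase univ (fun I => a I * _) (mem_univ ∅),
      sum_congr rfl fun I hI => by rw [hne I (ne_of_mem_erase hI)], ha0, ha',
      Function.update_self, prod_empty]
    ring
  refine hC ε h0 h1 n (fun I => r * a' I) (hdeg.const_mul r) ?_ ?_ f fun x => ?_
  · rw [← hr2, hW, mul_sum]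
    exact sum_congr rfl fun I hI => by rw [hne I (ne_of_mem_erase hI), mul_pow]
  · unfold Regular at hreg ⊢
    simp only [hwsq, mul_pow, ← mul_sum]
    rw [mul_left_comm]
    gcongr
  · rw [hf, mlEval_const_mul, heval, mul_nonneg_iff_of_pos_left hr0]

end
end
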